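/- Let 0<q<1, v > -1 and n, m, k ∈ ℤ. Then E_{v,v}(q^m,q^n,q^k) = (1-q) Σ_{i=0}^∞ ((q^{-2v};q²)_i/(q²;q²)_i) q^{i(2+2v)} D_v(q^m,q^{i+n},q^k), the series converging absolutely. -/

import Mathlib

open scoped BigOperators

noncomputable section

/-- Finite q-Pochhammer symbol `(a;q)_n = ∏_{i=0}^{n-1} (1 - a q^i)`. -/
def qPoch (a q : ℝ) (n : ℕ) : ℝ := ∏ i ∈ Finset.range n, (1 - a * q ^ i)

/-- Infinite q-Pochhammer symbol `(a;q)_∞ = ∏_{i=0}^{∞} (1 - a q^i)`. -/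
def qPochInf (a q : ℝ) : ℝ := ∏' i : ℕ, (1 - a * q ^ i)

/-- Normalized Hahn–Exton q-Bessel function `j_v(x,q²)`. -/
def jHE (q v x : ℝ) : ℝ :=
  ∑' n : ℕ, (-1 : ℝ) ^ n * q ^ (n * (n + 1)) * x ^ (2 * n) /
    (qPoch (q ^ 2) (q ^ 2) n * qPoch (q ^ (2 * v + 2)) (q ^ 2) n)

/-- Hahn–Exton q-Bessel function with base `p`:
`J_v(x,p) = (x^v/(p;p)_∞) Σ_{n} (-1)^n p^{n(n+1)/2} (p^{v+n+1};p)_∞ x^{2n}/(p;p)_n`.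
With `p = q²` this is `J_v(x,q²)`. -/
def JHE (p v x : ℝ) : ℝ :=
  (x ^ v / qPochInf p p) *
    ∑' n : ℕ, (-1 : ℝ) ^ n * p ^ (((n : ℝ) * ((n : ℝ) + 1)) / 2) *
      qPochInf (p ^ (v + (n : ℝ) + 1)) p * x ^ (2 * n) / qPoch p p n

/-- The constant `c_{q,v}`. -/
def cqv (q v : ℝ) : ℝ :=
  (1 / (1 - q)) * qPochInf (q ^ (2 * v + 2)) (q ^ 2) / qPochInf (q ^ 2) (q ^ 2)

/-- Jackson q-integral on `[0,∞)`: `∫_0^∞ f(x) d_q x = (1-q) Σ_{n∈ℤ} q^n f(q^n)`. -/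
def jackson (q : ℝ) (f : ℝ → ℝ) : ℝ := (1 - q) * ∑' n : ℤ, q ^ n * f (q ^ n)

/-- The q-lattice `ℝ_q^+ = {q^n : n ∈ ℤ}`. -/
def Rq (q : ℝ) : Set ℝ := {x | ∃ n : ℤ, x = q ^ n}

/-- Membership in `L_{q,1,v}`: the Jackson integral `∫_0^∞ |f(x)| x^{2v+1} d_q x`
converges (absolutely). -/
def memL1 (q v : ℝ) (f : ℝ → ℝ) : Prop :=
  Summable fun n : ℤ => q ^ n * |f (q ^ n)| * (q ^ n) ^ (2 * v + 1 : ℝ)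

/-- q-Bessel Fourier transform `F_{q,v}`. -/
def qFourier (q v : ℝ) (f : ℝ → ℝ) (x : ℝ) : ℝ :=
  cqv q v * jackson q fun t => f t * jHE q v (x * t) * t ^ (2 * v + 1 : ℝ)

/-- q-translation operator `T_{q,x}^v`. -/
def qTrans (q v x : ℝ) (f : ℝ → ℝ) (y : ℝ) : ℝ :=
  cqv q v * jackson q fun t =>
    qFourier q v f t * jHE q v (x * t) * jHE q v (y * t) * t ^ (2 * v + 1 : ℝ)

/-- The kernel `D_v(x,y,z)`. -/
def Dker (q v x y z : ℝ) : ℝ :=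
  (cqv q v) ^ 2 * jackson q fun t =>
    jHE q v (x * t) * jHE q v (y * t) * jHE q v (z * t) * t ^ (2 * v + 1 : ℝ)

/-- Positivity of the q-translation operator `T_{q,x}^v`. -/
def IsPosT (q v x : ℝ) : Prop :=
  ∀ f : ℝ → ℝ, memL1 q v f → (∀ y ∈ Rq q, 0 ≤ f y) → ∀ y ∈ Rq q, 0 ≤ qTrans q v x f y

/-- The positivity domain `Q_v`. -/
def Qset (v : ℝ) : Set ℝ :=
  {q | q ∈ Set.Ioo (0 : ℝ) 1 ∧ ∀ x ∈ Rq q, IsPosT q v x}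

/-- The kernel `E_{v,x}(q^m,q^z,q^k)`. -/
def Ekern (q v x : ℝ) (m z k : ℤ) : ℝ :=
  (1 / ((1 - q) ^ 2 * cqv q v * cqv q (x - v))) *
    q ^ (-(k : ℝ) * (x + 2) - (m : ℝ) * v - (z : ℝ) * (x - v)) *
    JHE (q ^ 2) ((z : ℝ) - (k : ℝ)) (q ^ (x - v + (m : ℝ) - (k : ℝ))) *
    JHE (q ^ 2) (v + (z : ℝ) - (k : ℝ)) (q ^ ((m : ℝ) - (k : ℝ)))

/-- The function `q ↦ ₁φ₁(0;q;q,q) = Σ_{n} (-1)^n q^{n(n+1)/2} q^n /((q;q)_n)²`. -/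
def phiQ (q : ℝ) : ℝ :=
  ∑' n : ℕ, (-1 : ℝ) ^ n * q ^ (((n : ℝ) * ((n : ℝ) + 1)) / 2) * q ^ n / (qPoch q q n) ^ 2

/-! ### Euler's expansion of the infinite q-Pochhammer symbol -/

/-- Coefficients of Euler's expansion `(x;p)_∞ = Σ_s eulerCoeff p s * x ^ s`. -/
def eulerCoeff (p : ℝ) (s : ℕ) : ℝ := (-1) ^ s * p ^ (s.choose 2) / qPoch p p s

lemma qPoch_succ (a p : ℝ) (n : ℕ) : qPoch a p (n + 1) = qPoch a p n * (1 - a * p ^ n) := by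
  simp [qPoch, Finset.prod_range_succ]

lemma qPoch_pos {a p : ℝ} (hp0 : 0 < p) (hp1 : p < 1) (ha1 : a < 1) (n : ℕ) :
    0 < qPoch a p n := by
  refine Finset.prod_pos fun i _ => ?_
  have h1 : p ^ i ≤ 1 := pow_le_one₀ hp0.le hp1.le
  have h2 : 0 < p ^ i := pow_pos hp0 i
  nlinarith

lemma eulerCoeff_zero (p : ℝ) : eulerCoeff p 0 = 1 := by simp [eulerCoeff, qPoch]

lemma eulerCoeff_succ {p : ℝ} (hp0 : 0 < p) (hp1 : p < 1) (s : ℕ) :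
    eulerCoeff p (s + 1) * (1 - p ^ (s + 1)) = -(p ^ s * eulerCoeff p s) := by
  have h1 := (qPoch_pos hp0 hp1 hp1 s).ne'
  have h2 : 1 - p * p ^ s ≠ 0 := by
    have := pow_lt_one₀ hp0.le hp1 (Nat.succ_ne_zero s)
    rw [pow_succ'] at this
    linarith
  have h3 : (s + 1).choose 2 = s + s.choose 2 := by
    rw [Nat.choose_succ_succ' s 1, Nat.choose_one_right]
  rw [eulerCoeff, eulerCoeff, qPoch_succ, h3, pow_succ' p s]
  field_simp
  ring

lemma abs_eulerCoeff {p : ℝ} (hp0 : 0 < p) (hp1 : p < 1) (s : ℕ) :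
    |eulerCoeff p s| = (-1) ^ s * eulerCoeff p s := by
  have h1 := qPoch_pos hp0 hp1 hp1 s
  rw [eulerCoeff, abs_div, abs_mul, abs_pow, abs_neg, abs_one, one_pow, abs_of_pos h1,
    abs_of_pos (pow_pos hp0 _), mul_div_assoc ((-1 : ℝ) ^ s), ← mul_assoc, ← mul_pow]
  simp

lemma eulerCoeff_ne_zero {p : ℝ} (hp0 : 0 < p) (hp1 : p < 1) (s : ℕ) : eulerCoeff p s ≠ 0 := by
  have h1 := (qPoch_pos hp0 hp1 hp1 s).ne'
  have := hp0.ne'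
  rw [eulerCoeff]
  positivity

lemma summable_eulerCoeff {p : ℝ} (hp0 : 0 < p) (hp1 : p < 1) (x : ℝ) :
    Summable fun s : ℕ => |eulerCoeff p s| * |x| ^ s := by
  rcases eq_or_ne x 0 with rfl | hx
  · refine summable_of_ne_finset_zero (s := {0}) fun s hs => ?_
    simp at hs
    simp [hs]
  have hlim : Filter.Tendsto (fun s : ℕ => p ^ s * |x| / (1 - p ^ (s + 1))) Filter.atTop
      (nhds (0 * |x| / (1 - 0))) := by
    have h := tendsto_pow_atTop_nhds_zero_of_lt_one hp0.le hp1
    exact (h.mul_const _).div (tendsto_const_nhds.sub ((Filter.tendsto_add_atTop_iff_nat 1).2 h))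
      (by norm_num)
  refine summable_of_ratio_test_tendsto_lt_one (l := 0) one_pos ?_ ?_
  · refine Filter.Eventually.of_forall fun s => ?_
    have := eulerCoeff_ne_zero hp0 hp1 s
    positivity
  · simp only [zero_mul, zero_div] at hlim
    refine hlim.congr fun s => ?_
    have h2 : 0 < 1 - p ^ (s + 1) := sub_pos.2 (pow_lt_one₀ hp0.le hp1 (Nat.succ_ne_zero s))
    have h3 := congrArg abs (eulerCoeff_succ hp0 hp1 s)
    rw [abs_mul, abs_neg, abs_mul, abs_of_pos h2, abs_of_pos (pow_pos hp0 s)] at h3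
    have h4 := abs_pos.2 (eulerCoeff_ne_zero hp0 hp1 s)
    have h5 := abs_pos.2 hx
    have h6 : |eulerCoeff p (s + 1)| = p ^ s * |eulerCoeff p s| / (1 - p ^ (s + 1)) := by
      rw [← h3]; field_simp
    rw [Real.norm_of_nonneg (by positivity), Real.norm_of_nonneg (by positivity), h6]
    field_simp
    ring

/-- A power series evaluated along `x * p ^ n` tends to its constant coefficient. -/
lemma tendsto_powerSeries {p : ℝ} (hp0 : 0 < p) (hp1 : p < 1) {c : ℕ → ℝ} {x : ℝ}
    (hc : Summable fun s => |c s| * |x| ^ s) :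
    Filter.Tendsto (fun n : ℕ => ∑' s, c s * (x * p ^ n) ^ s) Filter.atTop (nhds (c 0)) := by
  have h0 : ∑' s, (if s = 0 then c 0 else 0) = c 0 := tsum_ite_eq 0 (fun _ => c 0)
  rw [← h0]
  refine tendsto_tsum_of_dominated_convergence hc (fun s => ?_)
    (Filter.Eventually.of_forall fun n s => ?_)
  · rcases eq_or_ne s 0 with rfl | hs
    · simp
    · rw [if_neg hs]
      have h := (tendsto_pow_atTop_nhds_zero_of_lt_one hp0.le hp1).const_mul x
      have h' := (h.pow s).const_mul (c s)
      simpa [hs] using h'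
  · rw [Real.norm_eq_abs, abs_mul, abs_pow, abs_mul, abs_of_pos (pow_pos hp0 n)]
    have : p ^ n ≤ 1 := pow_le_one₀ hp0.le hp1.le
    gcongr
    exact mul_le_of_le_one_right (abs_nonneg x) this

lemma multipliable_qPochInf {p : ℝ} (hp0 : 0 < p) (hp1 : p < 1) (b : ℝ) :
    Multipliable fun i : ℕ => (1 - b * p ^ i) := by
  simp only [sub_eq_add_neg]
  exact Real.multipliable_one_add_of_summable
    ((summable_geometric_of_lt_one hp0.le hp1).mul_left b).neg

lemma qPochInf_eq_mul {p : ℝ} (hp0 : 0 < p) (hp1 : p < 1) (b : ℝ) :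
    qPochInf b p = (1 - b) * qPochInf (b * p) p := by
  rw [qPochInf, tprod_eq_zero_mul', qPochInf]
  · simp [pow_succ', mul_assoc]
  · simpa [pow_succ', mul_assoc] using multipliable_qPochInf hp0 hp1 (b * p)

lemma tendsto_qPoch {p : ℝ} (hp0 : 0 < p) (hp1 : p < 1) (b : ℝ) :
    Filter.Tendsto (fun n => qPoch b p n) Filter.atTop (nhds (qPochInf b p)) :=
  (multipliable_qPochInf hp0 hp1 b).tendsto_prod_tprod_nat

lemma hasSum_qPochInf {p : ℝ} (hp0 : 0 < p) (hp1 : p < 1) (x : ℝ) :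
    HasSum (fun s => eulerCoeff p s * x ^ s) (qPochInf x p) := by
  have hs : ∀ x, Summable fun s => eulerCoeff p s * x ^ s := fun x =>
    Summable.of_norm (by simpa [abs_mul] using summable_eulerCoeff hp0 hp1 x)
  set F : ℝ → ℝ := fun x => ∑' s, eulerCoeff p s * x ^ s with hF
  have hrec : ∀ x, F x = (1 - x) * F (x * p) := by
    intro x
    have h1 : F x - F (x * p) = -x * F (x * p) := by
      have e1 : F x - F (x * p) = ∑' s, eulerCoeff p s * (1 - p ^ s) * x ^ s := by
        rw [hF]
        simp only
        rw [← (hs x).tsum_sub (hs (x * p))]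
        exact tsum_congr fun s => by rw [mul_pow]; ring
      have e2 : Summable fun s => eulerCoeff p s * (1 - p ^ s) * x ^ s :=
        ((hs x).sub (hs (x * p))).congr fun s => by rw [mul_pow]; ring
      rw [e1, e2.tsum_eq_zero_add, hF]
      simp only [pow_zero, sub_self, mul_zero, zero_mul, zero_add]
      rw [← tsum_mul_left]
      refine tsum_congr fun s => ?_
      rw [eulerCoeff_succ hp0 hp1, mul_pow]; ring
    linarith
  have hn : ∀ n x, F x = qPoch x p n * F (x * p ^ n) := by
    intro n
    induction n with
    | zero => intro x; simp [qPoch]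
    | succ n ih =>
      intro x
      rw [ih x, hrec (x * p ^ n), qPoch_succ, pow_succ]
      ring_nf
  have hlim : Filter.Tendsto (fun n : ℕ => qPoch x p n * F (x * p ^ n)) Filter.atTop
      (nhds (qPochInf x p * eulerCoeff p 0)) :=
    (tendsto_qPoch hp0 hp1 x).mul (tendsto_powerSeries hp0 hp1 (summable_eulerCoeff hp0 hp1 x))
  have : F x = qPochInf x p := by
    have h := tendsto_nhds_unique
      (tendsto_const_nhds.congr fun n => hn n x) hlim
    simpa [eulerCoeff_zero] using h
  rw [← this]
  exact (hs x).hasSum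

lemma qPochInf_pos {p b : ℝ} (hp0 : 0 < p) (hp1 : p < 1) (hb1 : b < 1) : 0 < qPochInf b p := by
  have h1 : 0 ≤ qPochInf b p :=
    ge_of_tendsto' (tendsto_qPoch hp0 hp1 b) fun n => (qPoch_pos hp0 hp1 hb1 n).le
  refine lt_of_le_of_ne h1 (Ne.symm ?_)
  have hsm : Summable fun i : ℕ => -(b * p ^ i) :=
    ((summable_geometric_of_lt_one hp0.le hp1).mul_left b).neg
  have := tprod_one_add_ne_zero_of_summable (f := fun i : ℕ => -(b * p ^ i)) (fun i => by
    have h1 : p ^ i ≤ 1 := pow_le_one₀ hp0.le hp1.le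
    have h2 : 0 < p ^ i := pow_pos hp0 i
    nlinarith) hsm.norm
  simpa [qPochInf, sub_eq_add_neg] using this

lemma abs_qPochInf_le {p : ℝ} (hp0 : 0 < p) (hp1 : p < 1) {b : ℝ} (hb0 : 0 ≤ b) (hb1 : b ≤ 1) :
    |qPochInf b p| ≤ 1 := by
  refine le_of_tendsto' (tendsto_qPoch hp0 hp1 b).abs fun n => ?_
  rw [qPoch, Finset.abs_prod]
  refine Finset.prod_le_one (fun i _ => abs_nonneg _) fun i _ => ?_
  have h1 : p ^ i ≤ 1 := pow_le_one₀ hp0.le hp1.le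
  have h2 : 0 < p ^ i := pow_pos hp0 i
  rw [abs_le]
  constructor <;> nlinarith

lemma qPoch_mul_qPochInf {p : ℝ} (hp0 : 0 < p) (hp1 : p < 1) (b : ℝ) (n : ℕ) :
    qPoch b p n * qPochInf (b * p ^ n) p = qPochInf b p := by
  induction n with
  | zero => simp [qPoch]
  | succ n ih =>
    rw [← ih, qPochInf_eq_mul hp0 hp1 (b * p ^ n), qPoch_succ, pow_succ, mul_assoc b]
    ring

lemma abs_qPochInf_mul_le {p : ℝ} (hp0 : 0 < p) (hp1 : p < 1) (b : ℝ) (s : ℕ) :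
    |qPochInf (b * p ^ s) p| ≤ ∑' t, |eulerCoeff p t| * |b| ^ t := by
  have h := hasSum_qPochInf hp0 hp1 (b * p ^ s)
  rw [← h.tsum_eq, ← Real.norm_eq_abs]
  refine (tsum_of_norm_bounded (summable_eulerCoeff hp0 hp1 b).hasSum fun t => ?_)
  rw [Real.norm_eq_abs, abs_mul, abs_pow, abs_mul, abs_of_pos (pow_pos hp0 s)]
  have : p ^ s ≤ 1 := pow_le_one₀ hp0.le hp1.le
  gcongr
  exact mul_le_of_le_one_right (abs_nonneg b) this

/-! ### The entire function `G(b,z) = (b;p)_∞ · ₁φ₁(0;b;p,z)` -/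

/-- The function `G(b,z) = Σ_s (-1)^s p^{s(s-1)/2} z^s (b p^s;p)_∞ / (p;p)_s`, which is
`(b;p)_∞ · ₁φ₁(0;b;p,z)` extended to all `b`. -/
def besselG (p b z : ℝ) : ℝ := ∑' s, eulerCoeff p s * z ^ s * qPochInf (b * p ^ s) p

lemma summable_besselG {p : ℝ} (hp0 : 0 < p) (hp1 : p < 1) (b z : ℝ) :
    Summable fun s => eulerCoeff p s * z ^ s * qPochInf (b * p ^ s) p := by
  refine Summable.of_norm_bounded
    ((summable_eulerCoeff hp0 hp1 z).mul_right (∑' t, |eulerCoeff p t| * |b| ^ t)) fun s => ?_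
  rw [Real.norm_eq_abs, abs_mul, abs_mul, abs_pow]
  gcongr
  exact abs_qPochInf_mul_le hp0 hp1 b s

lemma besselG_sub_left {p : ℝ} (hp0 : 0 < p) (hp1 : p < 1) (b z : ℝ) :
    besselG p b z = besselG p (b * p) z - b * besselG p (b * p) (z * p) := by
  rw [besselG, besselG, besselG, ← tsum_mul_left,
    ← (summable_besselG hp0 hp1 (b * p) z).tsum_sub
      ((summable_besselG hp0 hp1 (b * p) (z * p)).mul_left b)]
  refine tsum_congr fun s => ?_
  rw [qPochInf_eq_mul hp0 hp1 (b * p ^ s), mul_right_comm b p, mul_pow]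
  ring

lemma besselG_comm {p : ℝ} (hp0 : 0 < p) (hp1 : p < 1) (b z : ℝ) :
    besselG p b z = besselG p z b := by
  have key : ∀ b z, besselG p b z =
      ∑' s, ∑' t, eulerCoeff p s * z ^ s * (eulerCoeff p t * (b * p ^ s) ^ t) := by
    intro b z
    rw [besselG]
    refine tsum_congr fun s => ?_
    rw [← (hasSum_qPochInf hp0 hp1 (b * p ^ s)).tsum_eq, tsum_mul_left]
  rw [key, key, Summable.tsum_comm]
  · refine tsum_congr fun s => tsum_congr fun t => ?_
    rw [mul_pow, mul_pow, ← pow_mul, ← pow_mul, mul_comm s t]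
    ring
  · have h := (summable_eulerCoeff hp0 hp1 b).mul_of_nonneg (summable_eulerCoeff hp0 hp1 z)
      (fun _ => by positivity) (fun _ => by positivity)
    refine Summable.of_norm_bounded h fun ⟨s, t⟩ => ?_
    simp only [Function.uncurry, Real.norm_eq_abs, abs_mul, abs_pow]
    rw [abs_of_pos hp0]
    have h1 : p ^ t ≤ 1 := pow_le_one₀ hp0.le hp1.le
    have h2 : |b| * p ^ t ≤ |b| := mul_le_of_le_one_right (abs_nonneg b) h1
    have h3 : (|b| * p ^ t) ^ s ≤ |b| ^ s := pow_le_pow_left₀ (by positivity) h2 s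
    rw [mul_comm (|eulerCoeff p s| * |b| ^ s)]
    exact mul_le_mul_of_nonneg_left (mul_le_mul_of_nonneg_left h3 (abs_nonneg _)) (by positivity)

lemma besselG_sub_right {p : ℝ} (hp0 : 0 < p) (hp1 : p < 1) (b z : ℝ) :
    besselG p b z = besselG p b (z * p) - z * besselG p (b * p) (z * p) := by
  rw [besselG_comm hp0 hp1 b z, besselG_sub_left hp0 hp1 z b, besselG_comm hp0 hp1 (z * p) b,
    besselG_comm hp0 hp1 (z * p) (b * p)]

/-- Reflection formula for `besselG` at the zeros of the infinite product. -/
lemma besselG_reflect {p : ℝ} (hp0 : 0 < p) (hp1 : p < 1) (b : ℝ) (m : ℕ) :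
    besselG p b (p ^ (1 - m : ℤ)) =
      (-1) ^ m * p ^ (m.choose 2) * b ^ m * besselG p (b * p ^ m) (p ^ (1 + m : ℤ)) := by
  induction m generalizing b with
  | zero => simp
  | succ m ih =>
    have e1 : (p : ℝ) ^ (1 - (m + 1 : ℕ) : ℤ) * p = p ^ (1 - m : ℤ) := by
      rw [← zpow_add_one₀ hp0.ne']; congr 1; push_cast; ring
    have e2 : (p : ℝ) ^ (1 + (m + 1 : ℕ) : ℤ) = p ^ (1 + m : ℤ) * p := by
      rw [← zpow_add_one₀ hp0.ne']; congr 1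
    have e3 : (p : ℝ) ^ (1 - (m + 1 : ℕ) : ℤ) * p ^ m = 1 := by
      rw [← zpow_natCast, ← zpow_add₀ hp0.ne']
      have : (1 - (m + 1 : ℕ) : ℤ) + m = 0 := by push_cast; ring
      rw [this, zpow_zero]
    have h := besselG_sub_left hp0 hp1 (b * p ^ m) (p ^ (1 + m : ℤ))
    rw [besselG_sub_right hp0 hp1, e1, ih, ih, h, e2]
    have e4 : (m + 1).choose 2 = m + m.choose 2 := by
      rw [Nat.choose_succ_succ' m 1, Nat.choose_one_right]
    have e5 : b * p * p ^ m = b * p ^ m * p := by ring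
    have e6 : b * p ^ (m + 1) = b * p ^ m * p := by ring
    rw [e4, e5, e6]
    set X := besselG p (b * p ^ m * p) (p ^ (1 + m : ℤ))
    set Y := besselG p (b * p ^ m * p) (p ^ (1 + m : ℤ) * p)
    rw [mul_pow b p m]
    linear_combination (-(-1) ^ m * p ^ m.choose 2 * b ^ m * X) * e3

/-- A uniform bound for `besselG` on the unit square. -/
def besselGBound (p : ℝ) : ℝ := ∑' s, |eulerCoeff p s|

lemma abs_besselG_le {p : ℝ} (hp0 : 0 < p) (hp1 : p < 1) {b z : ℝ} (hb0 : 0 ≤ b) (hb1 : b ≤ 1)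
    (hz0 : 0 ≤ z) (hz1 : z ≤ 1) : |besselG p b z| ≤ besselGBound p := by
  have hs : Summable fun s => |eulerCoeff p s| := by
    simpa using summable_eulerCoeff hp0 hp1 1
  rw [besselG, besselGBound, ← Real.norm_eq_abs]
  refine tsum_of_norm_bounded hs.hasSum fun s => ?_
  rw [Real.norm_eq_abs, abs_mul, abs_mul, abs_of_nonneg (pow_nonneg hz0 s)]
  have h1 : p ^ s ≤ 1 := pow_le_one₀ hp0.le hp1.le
  have h2 : z ^ s ≤ 1 := pow_le_one₀ hz0 hz1
  have h3 := abs_qPochInf_le hp0 hp1 (b := b * p ^ s) (by positivity) (mul_le_one₀ hb1 (by positivity) h1)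
  calc |eulerCoeff p s| * z ^ s * |qPochInf (b * p ^ s) p| ≤ |eulerCoeff p s| * 1 * 1 := by gcongr
    _ = _ := by ring

lemma besselGBound_nonneg (p : ℝ) : 0 ≤ besselGBound p := tsum_nonneg fun _ => abs_nonneg _

lemma abs_besselG_natCast_le {p : ℝ} (hp0 : 0 < p) (hp1 : p < 1) {b : ℝ} (hb0 : 0 ≤ b)
    (hb1 : b ≤ 1) (r : ℕ) : |besselG p b (p ^ (1 + r : ℤ))| ≤ besselGBound p := by
  refine abs_besselG_le hp0 hp1 hb0 hb1 (by positivity) ?_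
  have : (1 + r : ℤ) = ((1 + r : ℕ) : ℤ) := by push_cast; ring
  rw [this, zpow_natCast]
  exact pow_le_one₀ hp0.le hp1.le

lemma abs_besselG_neg_le {p : ℝ} (hp0 : 0 < p) (hp1 : p < 1) {b : ℝ} (hb0 : 0 ≤ b)
    (hb1 : b ≤ 1) (m : ℕ) :
    |besselG p b (p ^ (1 - m : ℤ))| ≤ besselGBound p * (b ^ m * p ^ (m.choose 2)) := by
  rw [besselG_reflect hp0 hp1, abs_mul, abs_mul, abs_mul, abs_pow, abs_neg, abs_one, one_pow,
    one_mul, abs_of_nonneg (pow_nonneg hp0.le _), abs_of_nonneg (pow_nonneg hb0 _)]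
  have h1 : p ^ m ≤ 1 := pow_le_one₀ hp0.le hp1.le
  have := abs_besselG_natCast_le hp0 hp1 (b := b * p ^ m) (by positivity)
    (mul_le_one₀ hb1 (by positivity) h1) m
  calc _ ≤ p ^ (m.choose 2) * b ^ m * besselGBound p := by gcongr
    _ = _ := by ring

lemma abs_besselG_zpow_le {p : ℝ} (hp0 : 0 < p) (hp1 : p < 1) {b : ℝ} (hb0 : 0 ≤ b)
    (hb1 : b ≤ 1) (r : ℤ) : |besselG p b (p ^ (1 + r))| ≤ besselGBound p := by
  obtain ⟨m, rfl | rfl⟩ := r.eq_nat_or_neg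
  · exact abs_besselG_natCast_le hp0 hp1 hb0 hb1 m
  · refine (abs_besselG_neg_le hp0 hp1 hb0 hb1 m).trans ?_
    refine mul_le_of_le_one_right (besselGBound_nonneg p) ?_
    exact mul_le_one₀ (pow_le_one₀ hb0 hb1) (by positivity) (pow_le_one₀ hp0.le hp1.le)

/-- The second-order `q`-difference equation of `besselG` in the argument. -/
lemma besselG_recurrence {p : ℝ} (hp0 : 0 < p) (hp1 : p < 1) (b z : ℝ) :
    p * besselG p b z + b * besselG p b (z * p * p) =
      (p + b - z * p) * besselG p b (z * p) := by
  have h1 := besselG_sub_right hp0 hp1 b z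
  have h2 := besselG_sub_right hp0 hp1 b (z * p)
  have h3 := besselG_sub_left hp0 hp1 b (z * p)
  linear_combination p * h1 - b * h2 + z * p * h3

/-! ### Lattice sums -/

/-- `besselG` on the lattice: `latticeG p b r = G(b, p^{1+r})`. -/
def latticeG (p b : ℝ) (r : ℤ) : ℝ := besselG p b (p ^ (1 + r))

lemma latticeG_recurrence {p : ℝ} (hp0 : 0 < p) (hp1 : p < 1) (b : ℝ) (r : ℤ) :
    p * latticeG p b (r - 1) + b * latticeG p b (r + 1) =
      (p + b - p ^ (1 + r)) * latticeG p b r := by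
  have h := besselG_recurrence hp0 hp1 b (p ^ r)
  rw [← zpow_add_one₀ hp0.ne', ← zpow_add_one₀ hp0.ne'] at h
  rw [latticeG, latticeG, latticeG, show 1 + (r - 1) = r by ring,
    show 1 + (r + 1) = r + 1 + 1 by ring, show 1 + r = r + 1 by ring]
  exact h

lemma pow_choose_le_abs_eulerCoeff {p : ℝ} (hp0 : 0 < p) (hp1 : p < 1) (n : ℕ) :
    p ^ (n.choose 2) ≤ |eulerCoeff p n| := by
  have h3 := qPoch_pos hp0 hp1 hp1 n
  have h4 : qPoch p p n ≤ 1 := by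
    refine Finset.prod_le_one (fun i _ => ?_) fun i _ => ?_
    · have : p ^ i ≤ 1 := pow_le_one₀ hp0.le hp1.le
      nlinarith
    · have : 0 < p ^ i := pow_pos hp0 i
      nlinarith
  rw [eulerCoeff, abs_div, abs_mul, abs_pow, abs_neg, abs_one, one_pow, one_mul,
    abs_of_pos h3, abs_of_pos (pow_pos hp0 _), le_div_iff₀ h3]
  exact mul_le_of_le_one_right (by positivity) h4

lemma summable_int_pow_mul_abs_latticeG {p a b : ℝ} (hp0 : 0 < p) (hp1 : p < 1) (ha0 : 0 < a)
    (ha1 : a < 1) (hb0 : 0 ≤ b) (hb1 : b ≤ 1) :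
    Summable fun r : ℤ => a ^ r * |latticeG p b r| := by
  refine Summable.of_nat_of_neg ?_ ?_
  · refine Summable.of_nonneg_of_le (fun n => by positivity) (fun n => ?_)
      ((summable_geometric_of_lt_one ha0.le ha1).mul_right (besselGBound p))
    rw [zpow_natCast]
    have := abs_besselG_zpow_le hp0 hp1 hb0 hb1 (n : ℤ)
    rw [latticeG]
    gcongr
  · have h := (summable_eulerCoeff hp0 hp1 (b / a)).mul_left (besselGBound p)
    refine Summable.of_nonneg_of_le (fun n => by positivity) (fun n => ?_) h
    have h1 := abs_besselG_neg_le hp0 hp1 hb0 hb1 n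
    have h2 := pow_choose_le_abs_eulerCoeff hp0 hp1 n
    rw [latticeG, ← sub_eq_add_neg, zpow_neg, zpow_natCast, abs_of_nonneg (div_nonneg hb0 ha0.le), div_pow]
    have h0 := besselGBound_nonneg p
    calc (a ^ n)⁻¹ * |besselG p b (p ^ (1 - n : ℤ))|
        ≤ (a ^ n)⁻¹ * (besselGBound p * (b ^ n * p ^ (n.choose 2))) := by gcongr
      _ ≤ (a ^ n)⁻¹ * (besselGBound p * (b ^ n * |eulerCoeff p n|)) := by gcongr
      _ = _ := by ring

lemma summable_int_pow_mul_abs_latticeG_add {p a b : ℝ} (hp0 : 0 < p) (hp1 : p < 1) (ha0 : 0 < a)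
    (ha1 : a < 1) (hb0 : 0 ≤ b) (hb1 : b ≤ 1) (M : ℤ) :
    Summable fun r : ℤ => a ^ r * |latticeG p b (M + r)| := by
  have h := (Equiv.addLeft M).summable_iff.2
    (summable_int_pow_mul_abs_latticeG hp0 hp1 ha0 ha1 hb0 hb1)
  refine (h.mul_left (a ^ (-M))).congr fun r => ?_
  simp only [Function.comp, Equiv.coe_addLeft]
  rw [← mul_assoc, ← zpow_add₀ ha0.ne']
  congr 2; ring

lemma summable_int_of_bounded {p a b C : ℝ} (hp0 : 0 < p) (hp1 : p < 1) (ha0 : 0 < a)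
    (ha1 : a < 1) (hb0 : 0 ≤ b) (hb1 : b ≤ 1) (M : ℤ) {f : ℤ → ℝ} (hf : ∀ r, |f r| ≤ C) :
    Summable fun r : ℤ => a ^ r * latticeG p b (M + r) * f r := by
  refine Summable.of_norm_bounded
    ((summable_int_pow_mul_abs_latticeG_add hp0 hp1 ha0 ha1 hb0 hb1 M).mul_right C) fun r => ?_
  rw [Real.norm_eq_abs, abs_mul, abs_mul, abs_of_pos (zpow_pos ha0 r)]
  have := hf r
  gcongr

/-- The bilateral sum of a product of three Bessel functions, one of them of order `0`. -/
def tripleSum (p a : ℝ) (M N : ℤ) : ℝ :=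
  ∑' r : ℤ, a ^ r * latticeG p a (M + r) * (latticeG p a r * latticeG p p (N + r))

/-- The closed form of `tripleSum`. -/
def tripleProd (p a : ℝ) (M N : ℤ) : ℝ :=
  qPochInf p p * p ^ (M * N) * besselG p (p ^ (1 + N)) (p ^ (1 + M)) *
    besselG p (a * p ^ N) (p ^ (1 + M))

lemma summable_tripleSum {p a : ℝ} (hp0 : 0 < p) (hp1 : p < 1) (ha0 : 0 < a) (ha1 : a < 1)
    (M N : ℤ) : Summable fun r : ℤ =>
      a ^ r * latticeG p a (M + r) * (latticeG p a r * latticeG p p (N + r)) := by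
  refine summable_int_of_bounded (C := besselGBound p * besselGBound p) hp0 hp1 ha0 ha1 ha0.le
    ha1.le M fun r => ?_
  rw [abs_mul]
  have h1 := abs_besselG_zpow_le hp0 hp1 ha0.le ha1.le r
  have h2 := abs_besselG_zpow_le hp0 hp1 hp0.le hp1.le (N + r)
  have := besselGBound_nonneg p
  rw [latticeG, latticeG]
  gcongr

lemma tripleSum_recurrence {p a : ℝ} (hp0 : 0 < p) (hp1 : p < 1) (ha0 : 0 < a) (ha1 : a < 1)
    (M N : ℤ) :
    p * p ^ M * (tripleSum p a M (N - 1) - 2 * tripleSum p a M N + tripleSum p a M (N + 1)) =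
      p ^ N * (p * tripleSum p a (M - 1) N - (p + a) * tripleSum p a M N
        + a * tripleSum p a (M + 1) N) := by
  have hs := fun M N => (summable_tripleSum hp0 hp1 ha0 ha1 M N).hasSum
  have h1 := ((((hs M (N - 1)).sub ((hs M N).mul_left 2)).add (hs M (N + 1))).mul_left (p * p ^ M))
  have h2 := (((((hs (M - 1) N).mul_left p).sub ((hs M N).mul_left (p + a))).add
    ((hs (M + 1) N).mul_left a)).mul_left (p ^ N))
  refine h1.unique (h2.congr_fun fun r => ?_)
  have e1 := latticeG_recurrence hp0 hp1 p (N + r)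
  have e2 := latticeG_recurrence hp0 hp1 a (M + r)
  rw [show N - 1 + r = N + r - 1 by ring, show N + 1 + r = N + r + 1 by ring,
    show M - 1 + r = M + r - 1 by ring, show M + 1 + r = M + r + 1 by ring]
  have e3 : p ^ M * p ^ (1 + (N + r)) = p ^ N * p ^ (1 + (M + r)) := by
    rw [← zpow_add₀ hp0.ne', ← zpow_add₀ hp0.ne']; congr 1; ring
  linear_combination (p ^ M * a ^ r * latticeG p a (M + r) * latticeG p a r) * e1
    - (p ^ N * a ^ r * latticeG p a r * latticeG p p (N + r)) * e2
    - (a ^ r * latticeG p a (M + r) * latticeG p a r * latticeG p p (N + r)) * e3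

lemma tripleSum_neg {p a : ℝ} (ha0 : 0 < a) (M N : ℤ) :
    tripleSum p a (-M) N = a ^ M * tripleSum p a M (N + M) := by
  rw [tripleSum, ← (Equiv.addLeft M).tsum_eq, tripleSum, ← tsum_mul_left]
  refine tsum_congr fun r => ?_
  rw [Equiv.coe_addLeft, zpow_add₀ ha0.ne', neg_add_cancel_left, add_assoc]
  ring

lemma tripleProd_neg {p : ℝ} (hp0 : 0 < p) (hp1 : p < 1) {a : ℝ} (m : ℕ) (N : ℤ) :
    tripleProd p a (-m) N = a ^ m * tripleProd p a m (N + m) := by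
  rw [tripleProd, tripleProd, ← sub_eq_add_neg, besselG_reflect hp0 hp1, besselG_reflect hp0 hp1]
  have e1 : p ^ (1 + N) * p ^ m = p ^ (1 + (N + m)) := by
    rw [← zpow_natCast, ← zpow_add₀ hp0.ne', add_assoc]
  have e2 : a * p ^ N * p ^ m = a * p ^ (N + m) := by
    rw [mul_assoc, ← zpow_natCast p m, ← zpow_add₀ hp0.ne']
  have e3 : p ^ (-(m : ℤ) * N) * ((-1) ^ m * p ^ m.choose 2 * (p ^ (1 + N)) ^ m) *
      ((-1) ^ m * p ^ m.choose 2 * (a * p ^ N) ^ m) = a ^ m * p ^ ((m : ℤ) * (N + m)) := by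
    have h1 : (m : ℤ) * (m : ℤ) = 2 * (m.choose 2 : ℕ) + m := by
      have : m * m = 2 * m.choose 2 + m := by
        rw [Nat.choose_two_right, Nat.mul_div_cancel' (Nat.even_mul_pred_self m).two_dvd]
        cases m with
        | zero => rfl
        | succ k => simp; ring
      exact_mod_cast this
    have h2 : ((-1 : ℝ) ^ m) * (-1) ^ m = 1 := by rw [← mul_pow]; simp
    rw [mul_pow a, ← zpow_natCast p (m.choose 2), ← zpow_natCast (p ^ (1 + N)) m,
      ← zpow_natCast (p ^ N) m, ← zpow_mul, ← zpow_mul]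
    have h3 : p ^ ((m : ℤ) * (N + m)) = p ^ (-(m : ℤ) * N) * p ^ ((m.choose 2 : ℕ) : ℤ) *
        p ^ ((1 + N) * (m : ℤ)) * p ^ ((m.choose 2 : ℕ) : ℤ) * p ^ (N * (m : ℤ)) := by
      rw [← zpow_add₀ hp0.ne', ← zpow_add₀ hp0.ne', ← zpow_add₀ hp0.ne', ← zpow_add₀ hp0.ne']
      congr 1
      linear_combination h1
    rw [h3]
    linear_combination (p ^ (-(m : ℤ) * N) * p ^ ((m.choose 2 : ℕ) : ℤ) *
        p ^ ((1 + N) * (m : ℤ)) * p ^ ((m.choose 2 : ℕ) : ℤ) * p ^ (N * (m : ℤ)) * a ^ m) * h2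
  rw [e1, e2]
  linear_combination (qPochInf p p * besselG p (p ^ (1 + (N + m))) (p ^ (1 + m : ℤ)) *
    besselG p (a * p ^ (N + m)) (p ^ (1 + m : ℤ))) * e3

lemma tripleProd_recurrence {p : ℝ} (hp0 : 0 < p) (hp1 : p < 1) {a : ℝ} (M N : ℤ) :
    p * p ^ M * (tripleProd p a M (N - 1) - 2 * tripleProd p a M N + tripleProd p a M (N + 1)) =
      p ^ N * (p * tripleProd p a (M - 1) N - (p + a) * tripleProd p a M N
        + a * tripleProd p a (M + 1) N) := by
  have hp := hp0.ne'
  have key : ∀ b, (besselG p (b * p ^ (-1 : ℤ)) (p ^ (1 + M)) = besselG p b (p ^ (1 + M))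
      - b / p * besselG p b (p ^ (1 + (M + 1)))) ∧
      (besselG p (b * p) (p ^ (1 + M)) = besselG p b (p ^ (1 + M))
        + b / p ^ (1 + M) * (besselG p b (p ^ (1 + (M + 1))) - besselG p b (p ^ (1 + M)))) ∧
      (besselG p b (p ^ (1 + (M - 1))) = besselG p b (p ^ (1 + M))
        - p ^ M * besselG p (b * p) (p ^ (1 + M))) := by
    intro b
    have hz : p ^ (1 + (M + 1)) = p ^ (1 + M) * p := by
      rw [← zpow_add_one₀ hp]; congr 1; ring
    have hz' : p ^ (1 + M) = p ^ M * p := by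
      rw [← zpow_add_one₀ hp]; congr 1; ring
    have h1 := besselG_sub_left hp0 hp1 (b * p ^ (-1 : ℤ)) (p ^ (1 + M))
    have h2 := besselG_sub_right hp0 hp1 b (p ^ (1 + M))
    have h3 := besselG_sub_left hp0 hp1 b (p ^ (1 + M))
    have h4 := besselG_sub_right hp0 hp1 b (p ^ M)
    have e : b * p ^ (-1 : ℤ) * p = b := by rw [zpow_neg_one]; field_simp
    rw [e] at h1
    rw [← hz'] at h4
    rw [← hz] at h1 h2 h3
    have hzz : p ^ (1 + M) ≠ 0 := (zpow_pos hp0 _).ne'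
    refine ⟨by rw [h1, zpow_neg_one]; ring, ?_, by rw [add_sub_cancel]; exact h4⟩
    field_simp
    linear_combination (-p ^ (1 + M)) * h3 + b * h2
  obtain ⟨a1, a2, a3⟩ := key (p ^ (1 + N))
  obtain ⟨b1, b2, b3⟩ := key (a * p ^ N)
  have f1 : p ^ (1 + (N - 1)) = p ^ (1 + N) * p ^ (-1 : ℤ) := by
    rw [← zpow_add₀ hp]; congr 1; ring
  have f2 : p ^ (1 + (N + 1)) = p ^ (1 + N) * p := by
    rw [← zpow_add_one₀ hp]; congr 1; ring
  have f3 : a * p ^ (N - 1) = a * p ^ N * p ^ (-1 : ℤ) := by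
    rw [mul_assoc, ← zpow_add₀ hp]; rfl
  have f4 : a * p ^ (N + 1) = a * p ^ N * p := by
    rw [mul_assoc, ← zpow_add_one₀ hp]
  have g1 : p ^ (M * (N - 1)) = p ^ (M * N) / p ^ M := by
    rw [← zpow_sub₀ hp]; congr 1; ring
  have g2 : p ^ (M * (N + 1)) = p ^ (M * N) * p ^ M := by
    rw [← zpow_add₀ hp]; congr 1; ring
  have g3 : p ^ ((M - 1) * N) = p ^ (M * N) / p ^ N := by
    rw [← zpow_sub₀ hp]; congr 1; ring
  have g4 : p ^ ((M + 1) * N) = p ^ (M * N) * p ^ N := by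
    rw [← zpow_add₀ hp]; congr 1; ring
  simp only [tripleProd]
  rw [f1, f2, f3, f4, a3, b3, a1, a2, b1, b2, g1, g2, g3, g4]
  rw [zpow_one_add₀ hp M, zpow_one_add₀ hp N]
  have hM : p ^ M ≠ 0 := (zpow_pos hp0 _).ne'
  have hN : p ^ N ≠ 0 := (zpow_pos hp0 _).ne'
  field_simp
  ring

/-! ### Orthogonality -/

/-- The orthogonality sum of the lattice functions `latticeG p a`. -/
def orthSum (p a : ℝ) (M : ℤ) : ℝ := ∑' r : ℤ, a ^ r * latticeG p a (M + r) * latticeG p a r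

lemma orthSum_eq_mul {p a : ℝ} (hp0 : 0 < p) (hp1 : p < 1) (ha0 : 0 < a) (ha1 : a < 1) (M : ℤ) :
    orthSum p a M = p ^ M * orthSum p (a * p) M := by
  have hb0 : 0 ≤ a * p := by positivity
  have hb1 : a * p ≤ 1 := mul_le_one₀ ha1.le hp0.le hp1.le
  have hs1 : Summable fun r : ℤ => a ^ r * latticeG p a (M + r) * latticeG p (a * p) r :=
    summable_int_of_bounded hp0 hp1 ha0 ha1 ha0.le ha1.le M
      fun r => abs_besselG_zpow_le hp0 hp1 hb0 hb1 r
  have hs2 : Summable fun r : ℤ => a ^ r * latticeG p a (M - 1 + r) * latticeG p (a * p) r :=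
    summable_int_of_bounded hp0 hp1 ha0 ha1 ha0.le ha1.le (M - 1)
      fun r => abs_besselG_zpow_le hp0 hp1 hb0 hb1 r
  have hs3 : HasSum (fun r : ℤ => a ^ (1 + r) * latticeG p a (M + r) * latticeG p (a * p) (1 + r))
      (∑' r : ℤ, a ^ r * latticeG p a (M - 1 + r) * latticeG p (a * p) r) := by
    refine ((Equiv.addLeft (1 : ℤ)).hasSum_iff.2 hs2.hasSum).congr_fun fun r => ?_
    simp only [Function.comp, Equiv.coe_addLeft]
    rw [show M - 1 + (1 + r) = M + r by ring]
  have h1 : HasSum (fun r : ℤ => a ^ r * latticeG p a (M + r) * latticeG p a r)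
      ((∑' r : ℤ, a ^ r * latticeG p a (M + r) * latticeG p (a * p) r) -
        ∑' r : ℤ, a ^ r * latticeG p a (M - 1 + r) * latticeG p (a * p) r) := by
    refine (hs1.hasSum.sub hs3).congr_fun fun r => ?_
    have h := besselG_sub_left hp0 hp1 a (p ^ (1 + r))
    rw [← zpow_add_one₀ hp0.ne', show 1 + r + 1 = 1 + (1 + r) by ring] at h
    rw [latticeG, latticeG, latticeG, h, zpow_one_add₀ ha0.ne']
    simp only [latticeG]
    ring
  rw [orthSum, h1.tsum_eq, ← hs1.tsum_sub hs2, orthSum, ← tsum_mul_left]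
  refine tsum_congr fun r => ?_
  have h := besselG_sub_right hp0 hp1 a (p ^ (M + r))
  rw [← zpow_add_one₀ hp0.ne', show M + r + 1 = 1 + (M + r) by ring] at h
  simp only [latticeG]
  rw [show 1 + (M - 1 + r) = M + r by ring, h, mul_zpow, zpow_add₀ hp0.ne' M r]
  ring

lemma summable_pow_natAbs_add {p a : ℝ} (hp0 : 0 < p) (hp1 : p < 1) (ha0 : 0 < a) (ha1 : a < 1) :
    Summable fun r : ℤ => a ^ r.natAbs + p ^ (r.natAbs.choose 2) := by
  have h : Summable fun n : ℕ => a ^ n + p ^ (n.choose 2) := by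
    refine (summable_geometric_of_lt_one ha0.le ha1).add ?_
    refine Summable.of_nonneg_of_le (fun n => by positivity)
      (pow_choose_le_abs_eulerCoeff hp0 hp1) ?_
    simpa using summable_eulerCoeff hp0 hp1 1
  exact Summable.of_nat_of_neg (by simpa using h) (by simpa using h)

lemma abs_orthSum_term_le {p a b : ℝ} (hp0 : 0 < p) (hp1 : p < 1) (hb0 : 0 < b)
    (hba : b ≤ a) (ha1 : a < 1) (M r : ℤ) :
    |b ^ r * latticeG p b (M + r) * latticeG p b r| ≤
      besselGBound p ^ 2 * (a ^ r.natAbs + p ^ (r.natAbs.choose 2)) := by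
  have hb1 : b ≤ 1 := hba.trans ha1.le
  have h1 := abs_besselG_zpow_le hp0 hp1 hb0.le hb1 (M + r)
  have h0 := besselGBound_nonneg p
  rw [abs_mul, abs_mul, abs_of_pos (zpow_pos hb0 r)]
  have ha0 := hb0.trans_le hba
  obtain ⟨n, rfl | rfl⟩ := r.eq_nat_or_neg
  · have h2 := abs_besselG_zpow_le hp0 hp1 hb0.le hb1 n
    simp only [latticeG, zpow_natCast, Int.natAbs_natCast]
    calc _ ≤ a ^ n * besselGBound p * besselGBound p := by gcongr
      _ = besselGBound p ^ 2 * a ^ n := by ring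
      _ ≤ _ := by
        gcongr
        exact le_add_of_nonneg_right (by positivity)
  · have h2 := abs_besselG_neg_le hp0 hp1 hb0.le hb1 n
    rw [sub_eq_add_neg] at h2
    simp only [latticeG, zpow_neg, zpow_natCast, Int.natAbs_neg, Int.natAbs_natCast]
    have hbn := (pow_pos hb0 n).ne'
    calc _ ≤ (b ^ n)⁻¹ * besselGBound p * (besselGBound p * (b ^ n * p ^ (n.choose 2))) := by
          gcongr
      _ = besselGBound p ^ 2 * p ^ (n.choose 2) := by field_simp
      _ ≤ _ := by
        gcongr
        exact le_add_of_nonneg_left (by positivity)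

lemma abs_orthSum_term_le_pow {p b : ℝ} (hp0 : 0 < p) (hp1 : p < 1) (hb0 : 0 < b)
    (hb1 : b ≤ 1) (r : ℤ) :
    |b ^ r * latticeG p b r * latticeG p b r| ≤ besselGBound p ^ 2 * b ^ r.natAbs := by
  have h0 := besselGBound_nonneg p
  rw [abs_mul, abs_mul, abs_of_pos (zpow_pos hb0 r)]
  obtain ⟨n, rfl | rfl⟩ := r.eq_nat_or_neg
  · have h2 := abs_besselG_zpow_le hp0 hp1 hb0.le hb1 n
    simp only [latticeG, zpow_natCast, Int.natAbs_natCast]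
    calc _ ≤ b ^ n * besselGBound p * besselGBound p := by gcongr
      _ = _ := by ring
  · have h2 := abs_besselG_neg_le hp0 hp1 hb0.le hb1 n
    rw [sub_eq_add_neg] at h2
    simp only [latticeG, zpow_neg, zpow_natCast, Int.natAbs_neg, Int.natAbs_natCast]
    have hbn := (pow_pos hb0 n).ne'
    have hpn : p ^ (n.choose 2) ≤ 1 := pow_le_one₀ hp0.le hp1.le
    calc _ ≤ (b ^ n)⁻¹ * (besselGBound p * (b ^ n * 1)) * (besselGBound p * (b ^ n * 1)) := by
          have h3 := h2.trans (show _ ≤ besselGBound p * (b ^ n * 1) by gcongr)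
          gcongr
      _ = _ := by field_simp

lemma orthSum_eq_pow_mul {p a : ℝ} (hp0 : 0 < p) (hp1 : p < 1) (ha0 : 0 < a) (ha1 : a < 1)
    (M : ℤ) (n : ℕ) : orthSum p a M = (p ^ M) ^ n * orthSum p (a * p ^ n) M := by
  induction n with
  | zero => simp
  | succ n ih =>
    have h1 : p ^ n ≤ 1 := pow_le_one₀ hp0.le hp1.le
    rw [ih, orthSum_eq_mul hp0 hp1 (by positivity)
      (lt_of_le_of_lt (mul_le_of_le_one_right ha0.le h1) ha1), pow_succ, pow_succ, mul_assoc a]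
    ring

lemma orthSum_natCast {p a : ℝ} (hp0 : 0 < p) (hp1 : p < 1) (ha0 : 0 < a) (ha1 : a < 1) {m : ℕ}
    (hm : m ≠ 0) : orthSum p a m = 0 := by
  have hsum := (summable_pow_natAbs_add hp0 hp1 ha0 ha1).mul_left (besselGBound p ^ 2)
  have hb : ∀ n : ℕ, |orthSum p a m| ≤
      (p ^ m) ^ n * ∑' r : ℤ, besselGBound p ^ 2 * (a ^ r.natAbs + p ^ (r.natAbs.choose 2)) := by
    intro n
    have h1 : p ^ n ≤ 1 := pow_le_one₀ hp0.le hp1.le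
    rw [orthSum_eq_pow_mul hp0 hp1 ha0 ha1 m n, abs_mul, zpow_natCast, abs_of_pos (by positivity)]
    gcongr
    rw [orthSum, ← Real.norm_eq_abs]
    exact tsum_of_norm_bounded hsum.hasSum fun r => abs_orthSum_term_le hp0 hp1 (by positivity)
      (mul_le_of_le_one_right ha0.le h1) ha1 m r
  have hlim := (tendsto_pow_atTop_nhds_zero_of_lt_one (pow_nonneg hp0.le m)
    (pow_lt_one₀ hp0.le hp1 hm)).mul_const
    (∑' r : ℤ, besselGBound p ^ 2 * (a ^ r.natAbs + p ^ (r.natAbs.choose 2)))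
  rw [zero_mul] at hlim
  exact abs_nonpos_iff.1 (ge_of_tendsto' hlim hb)

lemma orthSum_zero {p a : ℝ} (hp0 : 0 < p) (hp1 : p < 1) (ha0 : 0 < a) (ha1 : a < 1) :
    orthSum p a 0 = qPochInf p p ^ 2 := by
  have hsum := (summable_pow_natAbs_add hp0 hp1 ha0 ha1).mul_left (besselGBound p ^ 2)
  have hle : ∀ n : ℕ, a * p ^ n ≤ a := fun n =>
    mul_le_of_le_one_right ha0.le (pow_le_one₀ hp0.le hp1.le)
  have h0 : ∑' r : ℤ, (if r = 0 then qPochInf p p ^ 2 else 0) = qPochInf p p ^ 2 :=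
    tsum_ite_eq 0 (fun _ => qPochInf p p ^ 2)
  have hlim0 : Filter.Tendsto (fun n : ℕ => a * p ^ n) Filter.atTop (nhds 0) := by
    simpa using (tendsto_pow_atTop_nhds_zero_of_lt_one hp0.le hp1).const_mul a
  have hlim : Filter.Tendsto (fun n : ℕ => orthSum p (a * p ^ n) 0) Filter.atTop
      (nhds (qPochInf p p ^ 2)) := by
    rw [← h0]
    refine tendsto_tsum_of_dominated_convergence hsum (fun r => ?_)
      (Filter.Eventually.of_forall fun n r => abs_orthSum_term_le hp0 hp1 (by positivity)
        (hle n) ha1 0 r)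
    rcases eq_or_ne r 0 with rfl | hr
    · simp only [zpow_zero, one_mul, add_zero, if_true, latticeG, zpow_one]
      have hc : Summable fun s => |eulerCoeff p s * qPochInf (p * p ^ s) p| * |a| ^ s := by
        refine Summable.of_nonneg_of_le (fun s => by positivity) (fun s => ?_)
          ((summable_eulerCoeff hp0 hp1 a).mul_right (∑' t, |eulerCoeff p t| * |p| ^ t))
        rw [abs_mul, mul_right_comm]
        gcongr
        exact abs_qPochInf_mul_le hp0 hp1 p s
      have h := tendsto_powerSeries hp0 hp1 hc
      rw [pow_zero, mul_one, eulerCoeff_zero, one_mul] at h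
      have h' : Filter.Tendsto (fun n : ℕ => besselG p (a * p ^ n) p) Filter.atTop
          (nhds (qPochInf p p)) := by
        refine h.congr fun n => ?_
        rw [besselG_comm hp0 hp1, besselG]
        exact tsum_congr fun s => by ring
      rw [sq]
      exact h'.mul h'
    · rw [if_neg hr]
      have hz : Filter.Tendsto (fun n : ℕ => besselGBound p ^ 2 * (a * p ^ n) ^ r.natAbs)
          Filter.atTop (nhds 0) := by
        have := (hlim0.pow r.natAbs).const_mul (besselGBound p ^ 2)
        simpa [hr] using this
      refine squeeze_zero_norm (fun n => ?_) hz
      have := abs_orthSum_term_le_pow hp0 hp1 (b := a * p ^ n) (by positivity)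
        ((hle n).trans ha1.le) r
      simpa using this
  refine tendsto_nhds_unique (tendsto_const_nhds.congr fun n => ?_) hlim
  rw [orthSum_eq_pow_mul hp0 hp1 ha0 ha1 0 n]
  simp

/-! ### Power series in `p ^ N` -/

lemma hasSum_qPochInf_neg {p : ℝ} (hp0 : 0 < p) (hp1 : p < 1) (x : ℝ) :
    HasSum (fun s => |eulerCoeff p s| * x ^ s) (qPochInf (-x) p) := by
  refine (hasSum_qPochInf hp0 hp1 (-x)).congr_fun fun s => ?_
  rw [abs_eulerCoeff hp0 hp1, neg_pow]
  ring

lemma qPochInf_neg_mul_le {p : ℝ} (hp0 : 0 < p) (hp1 : p < 1) {x : ℝ} (hx : 0 ≤ x) (n : ℕ) :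
    qPochInf (-(x * p ^ n)) p ≤ qPochInf (-x) p := by
  refine hasSum_le (fun s => ?_) (hasSum_qPochInf_neg hp0 hp1 _) (hasSum_qPochInf_neg hp0 hp1 _)
  have : x * p ^ n ≤ x := mul_le_of_le_one_right hx (pow_le_one₀ hp0.le hp1.le)
  gcongr

lemma pow_choose_mul_qPochInf_neg_le {p : ℝ} (hp0 : 0 < p) (hp1 : p < 1) {x : ℝ} (hx : 0 ≤ x)
    (n : ℕ) :
    p ^ (n.choose 2) * qPochInf (-(x * (p ^ n)⁻¹)) p ≤ (1 + x / p) ^ n * qPochInf (-x) p := by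
  induction n with
  | zero => simp
  | succ n ih =>
    have h1 : p ^ n ≤ 1 := pow_le_one₀ hp0.le hp1.le
    have h2 : 0 < qPochInf (-(x * (p ^ n)⁻¹)) p :=
      qPochInf_pos hp0 hp1 (by have : 0 ≤ x * (p ^ n)⁻¹ := by positivity
                               linarith)
    have h3 : -(x * (p ^ (n + 1))⁻¹) * p = -(x * (p ^ n)⁻¹) := by
      have := hp0.ne'
      field_simp
      ring
    rw [qPochInf_eq_mul hp0 hp1, h3, Nat.choose_succ_succ' n 1, Nat.choose_one_right, pow_add]
    have h4 : p ^ n * (1 - -(x * (p ^ (n + 1))⁻¹)) ≤ 1 + x / p := by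
      have : p ^ n * (1 - -(x * (p ^ (n + 1))⁻¹)) = p ^ n + x / p := by
        have := hp0.ne'
        field_simp
        ring
      rw [this]
      gcongr
    calc _ = p ^ n * (1 - -(x * (p ^ (n + 1))⁻¹)) *
          (p ^ (n.choose 2) * qPochInf (-(x * (p ^ n)⁻¹)) p) := by ring
      _ ≤ (1 + x / p) * ((1 + x / p) ^ n * qPochInf (-x) p) := by gcongr
      _ = _ := by ring

lemma abs_latticeG_mul_qPochInf_neg_le {p b : ℝ} (hp0 : 0 < p) (hp1 : p < 1) (hb0 : 0 ≤ b)
    (hb1 : b ≤ 1) {x : ℝ} (hx : 0 ≤ x) (r : ℤ) :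
    |latticeG p b r| * qPochInf (-(x * p ^ r)) p ≤
      besselGBound p * qPochInf (-x) p * (1 + ((1 + x / p)⁻¹) ^ r) := by
  have hB := besselGBound_nonneg p
  have hP : ∀ y : ℝ, 0 ≤ y → 0 ≤ qPochInf (-y) p := fun y hy =>
    (qPochInf_pos hp0 hp1 (by linarith)).le
  have hPx := hP x hx
  obtain ⟨n, rfl | rfl⟩ := r.eq_nat_or_neg
  · have h1 := abs_besselG_natCast_le hp0 hp1 hb0 hb1 n
    have h2 := qPochInf_neg_mul_le hp0 hp1 hx n
    rw [zpow_natCast, zpow_natCast, latticeG]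
    have h3 := hP (x * p ^ n) (by positivity)
    calc _ ≤ besselGBound p * qPochInf (-x) p := by gcongr
      _ ≤ _ := le_mul_of_one_le_right (by positivity)
        (le_add_of_nonneg_right (by positivity))
  · have h1 := abs_besselG_neg_le hp0 hp1 hb0 hb1 n
    have h2 := pow_choose_mul_qPochInf_neg_le hp0 hp1 hx n
    have h4 : b ^ n ≤ 1 := pow_le_one₀ hb0 hb1
    rw [sub_eq_add_neg] at h1
    rw [zpow_neg, zpow_natCast, zpow_neg, zpow_natCast, inv_pow, inv_inv, latticeG]
    have h3 := hP (x * (p ^ n)⁻¹) (by positivity)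
    calc _ ≤ besselGBound p * (1 * p ^ (n.choose 2)) * qPochInf (-(x * (p ^ n)⁻¹)) p := by
          have h5 := h1.trans (show _ ≤ besselGBound p * (1 * p ^ (n.choose 2)) by gcongr)
          gcongr
      _ = besselGBound p * (p ^ (n.choose 2) * qPochInf (-(x * (p ^ n)⁻¹)) p) := by ring
      _ ≤ besselGBound p * ((1 + x / p) ^ n * qPochInf (-x) p) := by gcongr
      _ = besselGBound p * qPochInf (-x) p * (1 + x / p) ^ n := by ring
      _ ≤ _ := by
        gcongr
        exact le_add_of_nonneg_left zero_le_one

/-- The `s`-th coefficient of `tripleSum p a M N` as a power series in `p ^ N`. -/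
def tripleSumCoeff (p a : ℝ) (M : ℤ) (s : ℕ) : ℝ :=
  eulerCoeff p s * p ^ s * qPochInf (p * p ^ s) p *
    ∑' r : ℤ, a ^ r * latticeG p a (M + r) * latticeG p a r * (p ^ r) ^ s

lemma summable_tripleSum_prod {p a : ℝ} (hp0 : 0 < p) (hp1 : p < 1) (ha0 : 0 < a) (ha1 : a < 1)
    (M N : ℤ) : Summable fun t : ℤ × ℕ =>
      a ^ t.1 * latticeG p a (M + t.1) * latticeG p a t.1 *
        (eulerCoeff p t.2 * (p ^ (1 + (N + t.1))) ^ t.2) := by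
  rw [← summable_norm_iff, summable_prod_of_nonneg fun _ => norm_nonneg _]
  have e : ∀ r : ℤ, p ^ (1 + (N + r)) = p ^ (1 + N) * p ^ r := fun r => by
    rw [← zpow_add₀ hp0.ne', add_assoc]
  have hterm : ∀ (r : ℤ), HasSum (fun s : ℕ => ‖a ^ r * latticeG p a (M + r) * latticeG p a r *
        (eulerCoeff p s * (p ^ (1 + (N + r))) ^ s)‖)
      (a ^ r * |latticeG p a (M + r)| *
        (|latticeG p a r| * qPochInf (-(p ^ (1 + N) * p ^ r)) p)) := by
    intro r
    rw [← mul_assoc]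
    refine ((hasSum_qPochInf_neg hp0 hp1 _).mul_left _).congr_fun fun s => ?_
    simp only [e, Real.norm_eq_abs, abs_mul, abs_pow, abs_of_pos (zpow_pos ha0 _),
      abs_of_pos (zpow_pos hp0 _)]
  refine ⟨fun r => (hterm r).summable, ?_⟩
  simp only [(hterm _).tsum_eq]
  set x : ℝ := p ^ (1 + N) with hx
  have hx0 : 0 < x := zpow_pos hp0 _
  set D := 1 + x / p with hD
  have hD1 : 1 < D := lt_add_of_pos_right _ (by positivity)
  have hD0 : 0 < D := by positivity
  have h1 := summable_int_pow_mul_abs_latticeG_add hp0 hp1 ha0 ha1 ha0.le ha1.le M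
  have h2 := summable_int_pow_mul_abs_latticeG_add (a := a * D⁻¹) hp0 hp1 (by positivity)
    ((mul_le_of_le_one_right ha0.le (inv_le_one_of_one_le₀ hD1.le)).trans_lt ha1) ha0.le ha1.le M
  refine Summable.of_nonneg_of_le (fun r => ?_) (fun r => ?_)
    ((h1.add h2).mul_left (besselGBound p * qPochInf (-x) p))
  · have : 0 < x * p ^ r := by positivity
    have := (qPochInf_pos hp0 hp1 (show -(x * p ^ r) < 1 by linarith)).le
    positivity
  · calc _ ≤ a ^ r * |latticeG p a (M + r)| *
          (besselGBound p * qPochInf (-x) p * (1 + (D⁻¹) ^ r)) := by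
          have := abs_latticeG_mul_qPochInf_neg_le hp0 hp1 ha0.le ha1.le hx0.le r
          gcongr
      _ = _ := by
        rw [mul_zpow]
        ring

lemma hasSum_tripleSum {p a : ℝ} (hp0 : 0 < p) (hp1 : p < 1) (ha0 : 0 < a) (ha1 : a < 1)
    (M N : ℤ) : HasSum (fun s => tripleSumCoeff p a M s * (p ^ N) ^ s) (tripleSum p a M N) := by
  have hs : Summable fun t : ℤ × ℕ =>
      a ^ t.1 * latticeG p a (M + t.1) * latticeG p a t.1 *
        (eulerCoeff p t.2 * (p ^ (1 + (N + t.1))) ^ t.2 * qPochInf (p * p ^ t.2) p) := by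
    refine Summable.of_norm_bounded (summable_tripleSum_prod hp0 hp1 ha0 ha1 M N).norm fun t => ?_
    have h := abs_qPochInf_le hp0 hp1 (b := p * p ^ t.2) (by positivity)
      (mul_le_one₀ hp1.le (by positivity) (pow_le_one₀ hp0.le hp1.le))
    rw [← mul_assoc _ (_ * _), norm_mul _ (qPochInf _ _)]
    exact mul_le_of_le_one_right (norm_nonneg _) h
  have h1 : tripleSum p a M N = ∑' t : ℤ × ℕ,
      a ^ t.1 * latticeG p a (M + t.1) * latticeG p a t.1 *
        (eulerCoeff p t.2 * (p ^ (1 + (N + t.1))) ^ t.2 * qPochInf (p * p ^ t.2) p) := by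
    rw [hs.tsum_prod, tripleSum]
    refine tsum_congr fun r => ?_
    dsimp only
    rw [tsum_mul_left, ← mul_assoc]
    rfl
  have hs' := hs.prod_symm
  have h2 := hs'.hasSum.prod_fiberwise fun s => (hs'.prod_factor s).hasSum
  rw [← (Equiv.prodComm ℤ ℕ).symm.tsum_eq] at h1
  rw [h1]
  refine h2.congr_fun fun s => ?_
  rw [tripleSumCoeff, mul_right_comm, ← tsum_mul_left]
  refine tsum_congr fun r => ?_
  simp only [Prod.fst_swap, Prod.snd_swap, zpow_add₀ hp0.ne', mul_pow, zpow_one]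
  ring

lemma tripleSumCoeff_zero (p a : ℝ) (M : ℤ) :
    tripleSumCoeff p a M 0 = qPochInf p p * orthSum p a M := by
  simp [tripleSumCoeff, orthSum, eulerCoeff_zero]

lemma exists_hasSum_tripleProd {p : ℝ} (hp0 : 0 < p) (hp1 : p < 1) (a : ℝ) (m : ℕ) :
    ∃ c : ℕ → ℝ, c 0 = (if m = 0 then qPochInf p p ^ 3 else 0) ∧
      ∀ N : ℤ, HasSum (fun s => c s * (p ^ N) ^ s) (tripleProd p a m N) := by
  set z : ℝ := p ^ (1 + m : ℤ) with hz
  set u : ℝ → ℕ → ℝ := fun x s => eulerCoeff p s * x ^ s * qPochInf (z * p ^ s) p with hu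
  set d : ℕ → ℝ := fun n =>
    ∑ ij ∈ Finset.HasAntidiagonal.antidiagonal n, u p ij.1 * u a ij.2 with hd
  refine ⟨fun s => if m ≤ s then qPochInf p p * d (s - m) else 0, ?_, fun N => ?_⟩
  · rcases eq_or_ne m 0 with rfl | hm
    · simp [hd, hu, eulerCoeff_zero, hz]
      ring
    · simp [hm]
  · have hm : ∀ x y n, u x n * y ^ n = u (x * y) n := fun x y n => by
      simp only [hu, mul_pow]
      ring
    have h1 := (summable_besselG hp0 hp1 z (p * p ^ N)).norm
    have h2 := (summable_besselG hp0 hp1 z (a * p ^ N)).norm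
    have h3 : HasSum (fun n => d n * (p ^ N) ^ n)
        (besselG p z (p * p ^ N) * besselG p z (a * p ^ N)) := by
      rw [besselG, besselG, tsum_mul_tsum_eq_tsum_sum_antidiagonal_of_summable_norm h1 h2]
      refine (summable_norm_sum_mul_antidiagonal_of_summable_norm h1 h2).of_norm.hasSum.congr_fun
        fun n => ?_
      rw [hd, Finset.sum_mul]
      refine Finset.sum_congr rfl fun ij hij => ?_
      rw [← Finset.HasAntidiagonal.mem_antidiagonal.1 hij, pow_add, mul_mul_mul_comm, hm, hm]
    rw [← (add_left_injective m).hasSum_iff]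
    · have h4 := h3.mul_left (qPochInf p p * (p ^ N) ^ m)
      have h5 : tripleProd p a m N = qPochInf p p * (p ^ N) ^ m *
          (besselG p z (p * p ^ N) * besselG p z (a * p ^ N)) := by
        rw [tripleProd, besselG_comm hp0 hp1 (p ^ (1 + N)), besselG_comm hp0 hp1 (a * p ^ N),
          zpow_add₀ hp0.ne' 1 N, zpow_one, mul_comm (m : ℤ), zpow_mul, zpow_natCast]
        ring
      rw [h5]
      refine h4.congr_fun fun n => ?_
      simp only [Function.comp_apply, le_add_iff_nonneg_left, zero_le, if_true,
        Nat.add_sub_cancel, pow_add]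
      ring
    · intro s hs
      have : ¬ m ≤ s := fun h => hs ⟨s - m, Nat.sub_add_cancel h⟩
      simp [this]

lemma coeff_eq_zero_of_hasSum_zero {p : ℝ} (hp0 : 0 < p) (hp1 : p < 1) {c : ℕ → ℝ}
    (hc : ∀ n : ℕ, HasSum (fun s => c s * (p ^ n) ^ s) 0) (s : ℕ) : c s = 0 := by
  have h0 : ∀ {c : ℕ → ℝ}, (∀ n : ℕ, HasSum (fun s => c s * (p ^ n) ^ s) 0) → c 0 = 0 := by
    intro c hc
    have h1 : Summable fun s => |c s| * |(1 : ℝ)| ^ s := by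
      simpa using (hc 0).summable.abs
    have h2 := tendsto_powerSeries hp0 hp1 h1
    simp only [one_mul, (hc _).tsum_eq] at h2
    exact tendsto_nhds_unique h2 tendsto_const_nhds
  induction s generalizing c with
  | zero => exact h0 hc
  | succ s ih =>
    refine ih (c := fun s => c (s + 1)) fun n => ?_
    have hpn := (pow_pos hp0 n).ne'
    have h1 := ((hasSum_nat_add_iff' 1).2 (hc n)).mul_left (p ^ n)⁻¹
    simp only [Finset.range_one, Finset.sum_singleton, h0 hc, zero_mul, sub_zero, mul_zero] at h1
    refine h1.congr_fun fun s => ?_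
    field_simp
    ring

lemma exists_hasSum_tripleSum_sub_tripleProd {p a : ℝ} (hp0 : 0 < p) (hp1 : p < 1) (ha0 : 0 < a)
    (ha1 : a < 1) (M : ℤ) : ∃ c : ℕ → ℝ, c 0 = 0 ∧
      ∀ N : ℤ, HasSum (fun s => c s * (p ^ N) ^ s) (tripleSum p a M N - tripleProd p a M N) := by
  have key : ∀ m : ℕ, ∃ c : ℕ → ℝ, c 0 = 0 ∧
      ∀ N : ℤ, HasSum (fun s => c s * (p ^ N) ^ s) (tripleSum p a m N - tripleProd p a m N) := by
    intro m
    obtain ⟨d, hd0, hd⟩ := exists_hasSum_tripleProd hp0 hp1 a m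
    refine ⟨fun s => tripleSumCoeff p a m s - d s, ?_, fun N => ?_⟩
    · dsimp only
      rcases eq_or_ne m 0 with rfl | hm
      · rw [hd0, tripleSumCoeff_zero, Nat.cast_zero, orthSum_zero hp0 hp1 ha0 ha1, if_pos rfl]
        ring
      · rw [hd0, tripleSumCoeff_zero, orthSum_natCast hp0 hp1 ha0 ha1 hm, if_neg hm]
        ring
    · simpa only [sub_mul] using (hasSum_tripleSum hp0 hp1 ha0 ha1 m N).sub (hd N)
  obtain ⟨m, rfl | rfl⟩ := M.eq_nat_or_neg
  · exact key m
  · obtain ⟨c, hc0, hc⟩ := key m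
    refine ⟨fun s => a ^ m * ((p ^ m) ^ s * c s), by simp [hc0], fun N => ?_⟩
    rw [tripleSum_neg ha0, tripleProd_neg hp0 hp1, zpow_natCast, ← mul_sub]
    refine ((hc (N + m)).mul_left (a ^ m)).congr_fun fun s => ?_
    rw [zpow_add₀ hp0.ne', zpow_natCast, mul_pow]
    ring

theorem tripleSum_eq_tripleProd {p a : ℝ} (hp0 : 0 < p) (hp1 : p < 1) (ha0 : 0 < a) (ha1 : a < 1)
    (M N : ℤ) : tripleSum p a M N = tripleProd p a M N := by
  have hp := hp0.ne'
  choose c hc0 hc using exists_hasSum_tripleSum_sub_tripleProd hp0 hp1 ha0 ha1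
  have hc' : ∀ M N, HasSum (fun s => c M (s + 1) * (p ^ N) ^ (s + 1))
      (tripleSum p a M N - tripleProd p a M N) := by
    intro M N
    simpa [hc0] using (hasSum_nat_add_iff' 1).2 (hc M N)
  have hrec : ∀ (s : ℕ) (M : ℤ), p * p ^ M * ((p ^ (s + 1))⁻¹ - 2 + p ^ (s + 1)) * c M (s + 1) =
      p * c (M - 1) s - (p + a) * c M s + a * c (M + 1) s := by
    intro s M
    rw [← sub_eq_zero]
    refine coeff_eq_zero_of_hasSum_zero hp0 hp1 (c := fun s =>
      p * p ^ M * ((p ^ (s + 1))⁻¹ - 2 + p ^ (s + 1)) * c M (s + 1) -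
      (p * c (M - 1) s - (p + a) * c M s + a * c (M + 1) s)) (fun n => ?_) s
    have hL := ((((hc' M (n - 1)).sub ((hc' M n).mul_left 2)).add (hc' M (n + 1))).mul_left
      (p * p ^ M)).mul_left (p ^ n)⁻¹
    have hR := (((hc (M - 1) n).mul_left p).sub ((hc M n).mul_left (p + a))).add
      ((hc (M + 1) n).mul_left a)
    have h1 := tripleSum_recurrence hp0 hp1 ha0 ha1 M n
    have h2 := tripleProd_recurrence hp0 hp1 (a := a) M n
    have hpn := (pow_pos hp0 n).ne'
    have hLR := hL.sub hR
    have h0 : ∀ {f : ℕ → ℝ} {L : ℝ}, HasSum f L → L = 0 → HasSum f 0 := fun h h' => h' ▸ h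
    refine (h0 hLR ?_).congr_fun fun s => ?_
    · rw [zpow_natCast] at h1 h2
      field_simp
      linear_combination h1 - h2
    · simp only [zpow_sub₀ hp, zpow_add₀ hp, zpow_one, zpow_natCast, div_pow, mul_pow]
      field_simp
      ring
  have hzero : ∀ (s : ℕ) (M : ℤ), c M s = 0 := by
    intro s
    induction s with
    | zero => exact hc0
    | succ s ih =>
      intro M
      have h := hrec s M
      rw [ih, ih, ih] at h
      have h1 : p ^ (s + 1) < 1 := pow_lt_one₀ hp0.le hp1 s.succ_ne_zero
      have h2 : (p ^ (s + 1))⁻¹ - 2 + p ^ (s + 1) = (1 - p ^ (s + 1)) ^ 2 / p ^ (s + 1) := by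
        field_simp
        ring
      have h3 : (1 - p ^ (s + 1)) ^ 2 / p ^ (s + 1) ≠ 0 := by
        have : 0 < 1 - p ^ (s + 1) := sub_pos.2 h1
        positivity
      rw [h2] at h
      have h4 : p * p ^ M * ((1 - p ^ (s + 1)) ^ 2 / p ^ (s + 1)) ≠ 0 :=
        mul_ne_zero (mul_ne_zero hp (zpow_ne_zero M hp)) h3
      exact (mul_eq_zero.1 (h.trans (by ring))).resolve_left h4
  have h := hc M N
  simp only [hzero, zero_mul] at h
  exact sub_eq_zero.1 (h.unique hasSum_zero)

/-! ### The `q`-binomial theorem and the interchange of summations -/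

lemma exists_abs_qPoch_div_le {p : ℝ} (hp0 : 0 < p) (hp1 : p < 1) (α : ℝ) :
    ∃ C, 0 ≤ C ∧ ∀ i, |qPoch α p i / qPoch p p i| ≤ C := by
  have h := ((tendsto_qPoch hp0 hp1 α).div (tendsto_qPoch hp0 hp1 p)
    (qPochInf_pos hp0 hp1 hp1).ne').abs
  obtain ⟨C, hC⟩ := h.bddAbove_range
  have hC' : ∀ i, |qPoch α p i / qPoch p p i| ≤ C := fun i => hC ⟨i, rfl⟩
  exact ⟨C, (abs_nonneg _).trans (hC' 0), hC'⟩

lemma hasSum_qBinomial {p : ℝ} (hp0 : 0 < p) (hp1 : p < 1) (α : ℝ) {z : ℝ} (hz : |z| < 1) :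
    HasSum (fun i => qPoch α p i / qPoch p p i * z ^ i) (qPochInf (α * z) p / qPochInf z p) := by
  obtain ⟨C, hC0, hC⟩ := exists_abs_qPoch_div_le hp0 hp1 α
  have hsn : ∀ w : ℝ, |w| < 1 → Summable fun i => |qPoch α p i / qPoch p p i| * |w| ^ i :=
    fun w hw => Summable.of_nonneg_of_le (fun i => by positivity)
      (fun i => mul_le_mul_of_nonneg_right (hC i) (by positivity))
      ((summable_geometric_of_lt_one (abs_nonneg w) hw).mul_left C)
  have hs : ∀ w : ℝ, |w| < 1 → Summable fun i => qPoch α p i / qPoch p p i * w ^ i :=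
    fun w hw => Summable.of_norm (by simpa only [norm_mul, norm_pow, Real.norm_eq_abs] using hsn w hw)
  set f : ℝ → ℝ := fun w => ∑' i, qPoch α p i / qPoch p p i * w ^ i with hf
  have hwp : ∀ w : ℝ, |w| < 1 → |w * p| < 1 := fun w hw => by
    rw [abs_mul, abs_of_pos hp0]
    exact mul_lt_one_of_nonneg_of_lt_one_left (abs_nonneg w) hw hp1.le
  have hstep : ∀ w : ℝ, |w| < 1 → (1 - w) * f w = (1 - α * w) * f (w * p) := by
    intro w hw
    have h1 := (hs w hw).hasSum
    have h2 := (hs (w * p) (hwp w hw)).hasSum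
    have h3 := (hasSum_nat_add_iff' 1).2 (h1.sub h2)
    have h4 := (h1.sub (h2.mul_left α)).mul_left w
    have h5 := h3.unique (h4.congr_fun fun i => ?_)
    · simp only [Finset.range_one, Finset.sum_singleton, pow_zero, mul_one, sub_self,
        sub_zero] at h5
      change f w - f (w * p) = w * (f w - α * f (w * p)) at h5
      linear_combination h5
    · have h6 := (qPoch_pos hp0 hp1 hp1 i).ne'
      have h7 : 1 - p * p ^ i ≠ 0 := by
        have := pow_lt_one₀ hp0.le hp1 i.succ_ne_zero
        rw [pow_succ'] at this
        exact (sub_pos.2 this).ne'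
      rw [qPoch_succ, qPoch_succ, ← mul_sub, mul_pow, mul_pow,
        show w ^ (i + 1) - w ^ (i + 1) * p ^ (i + 1) = w ^ (i + 1) * (1 - p * p ^ i) by ring]
      generalize 1 - p * p ^ i = y at h7 ⊢
      field_simp
      ring
  have hiter : ∀ n, qPoch z p n * f z = qPoch (α * z) p n * f (z * p ^ n) := by
    intro n
    induction n with
    | zero => simp [qPoch]
    | succ n ih =>
      have hzn : |z * p ^ n| < 1 := by
        rw [abs_mul, abs_of_pos (pow_pos hp0 n)]
        exact mul_lt_one_of_nonneg_of_lt_one_left (abs_nonneg z) hz (pow_le_one₀ hp0.le hp1.le)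
      have h := hstep _ hzn
      rw [mul_assoc z, ← pow_succ] at h
      rw [qPoch_succ, qPoch_succ]
      linear_combination (1 - z * p ^ n) * ih + qPoch (α * z) p n * h
  have hlim := (tendsto_qPoch hp0 hp1 (α * z)).mul (tendsto_powerSeries hp0 hp1 (hsn z hz))
  have hlim' := (tendsto_qPoch hp0 hp1 z).mul_const (f z)
  have h := tendsto_nhds_unique (hlim'.congr hiter) hlim
  have hzP := (qPochInf_pos hp0 hp1 (lt_of_abs_lt hz)).ne'
  have h0 : qPoch α p 0 / qPoch p p 0 = 1 := by simp [qPoch]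
  rw [h0, mul_one] at h
  rw [← h, mul_div_cancel_left₀ _ hzP]
  exact (hs z hz).hasSum

lemma hasSum_qBinomial_latticeG {p a α : ℝ} (hp0 : 0 < p) (hp1 : p < 1) (ha0 : 0 < a)
    (ha1 : a < 1) (hα : α * a = p) (N : ℤ) :
    HasSum (fun i : ℕ => qPoch α p i / qPoch p p i * a ^ i * latticeG p a (i + N))
      (latticeG p p N) := by
  obtain ⟨C, hC0, hC⟩ := exists_abs_qPoch_div_le hp0 hp1 α
  have haps : ∀ s : ℕ, 0 < a * p ^ s ∧ a * p ^ s < 1 := fun s =>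
    ⟨by positivity, mul_lt_one_of_nonneg_of_lt_one_left ha0.le ha1 (pow_le_one₀ hp0.le hp1.le)⟩
  have hs : Summable fun t : ℕ × ℕ => qPoch α p t.1 / qPoch p p t.1 * a ^ t.1 *
      (eulerCoeff p t.2 * (p ^ (1 + (t.1 + N))) ^ t.2 * qPochInf (a * p ^ t.2) p) := by
    refine Summable.of_norm_bounded (((summable_geometric_of_lt_one ha0.le ha1).mul_left C
      |>.mul_of_nonneg (summable_eulerCoeff hp0 hp1 (p ^ (1 + N)))) (fun i => by positivity)
      (fun s => by positivity)) fun t => ?_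
    have h1 := abs_qPochInf_le hp0 hp1 (haps t.2).1.le (haps t.2).2.le
    have h2 : (p : ℝ) ^ (1 + (t.1 + N)) ≤ p ^ (1 + N) :=
      zpow_le_zpow_right_of_le_one₀ hp0 hp1.le (by omega)
    simp only [Real.norm_eq_abs, abs_mul, abs_pow, abs_of_pos ha0, abs_of_pos (zpow_pos hp0 _)]
    calc _ ≤ C * a ^ t.1 * (|eulerCoeff p t.2| * (p ^ (1 + N)) ^ t.2 * 1) := by
          have := hC t.1
          have := zpow_pos hp0 (1 + (t.1 + N))
          gcongr
      _ = _ := by ring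
  have h1 := hs.hasSum.prod_fiberwise fun i => (hs.prod_factor i).hasSum
  have h2 : ∑' t : ℕ × ℕ, qPoch α p t.1 / qPoch p p t.1 * a ^ t.1 *
      (eulerCoeff p t.2 * (p ^ (1 + (t.1 + N))) ^ t.2 * qPochInf (a * p ^ t.2) p) =
      latticeG p p N := by
    rw [← (Equiv.prodComm ℕ ℕ).symm.tsum_eq]
    refine (hs.prod_symm.tsum_prod).trans (tsum_congr fun s => ?_)
    have h3 := (hasSum_qBinomial hp0 hp1 α (z := a * p ^ s)
      (by rw [abs_of_pos (haps s).1]; exact (haps s).2)).mul_left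
      (eulerCoeff p s * (p ^ (1 + N)) ^ s * qPochInf (a * p ^ s) p)
    have h4 := (qPochInf_pos hp0 hp1 (haps s).2).ne'
    rw [← mul_assoc, hα, mul_assoc _ (qPochInf _ _), mul_div_cancel₀ _ h4] at h3
    refine (h3.congr_fun fun i => ?_).tsum_eq
    simp only [Prod.fst_swap, Prod.snd_swap, mul_pow, zpow_add₀ hp0.ne', zpow_natCast,
      zpow_one, ← pow_mul, mul_comm s i]
    ring
  rw [h2] at h1
  refine h1.congr_fun fun i => ?_
  dsimp only
  rw [tsum_mul_left]
  rfl

lemma tsum_shift_eq_tripleSum {p a : ℝ} (ha0 : 0 < a) (m n k : ℤ) :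
    ∑' r : ℤ, a ^ r * latticeG p a (m + r) * (latticeG p a (k + r) * latticeG p p (n + r)) =
      (a ^ k)⁻¹ * tripleSum p a (m - k) (n - k) := by
  rw [← (Equiv.subRight k).tsum_eq, tripleSum, ← tsum_mul_left]
  refine tsum_congr fun r => ?_
  rw [Equiv.subRight_apply, zpow_sub₀ ha0.ne', show m + (r - k) = m - k + r by ring,
    show k + (r - k) = r by ring, show n + (r - k) = n - k + r by ring]
  ring

theorem hasSum_qBinomial_tripleLattice {p a α : ℝ} (hp0 : 0 < p) (hp1 : p < 1) (ha0 : 0 < a)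
    (ha1 : a < 1) (hα : α * a = p) (m n k : ℤ) :
    HasSum (fun i : ℕ => qPoch α p i / qPoch p p i * a ^ i *
      ∑' r : ℤ, a ^ r * latticeG p a (m + r) * (latticeG p a (k + r) * latticeG p a (i + n + r)))
      ((a ^ k)⁻¹ * tripleProd p a (m - k) (n - k)) := by
  obtain ⟨C, hC0, hC⟩ := exists_abs_qPoch_div_le hp0 hp1 α
  have hB := besselGBound_nonneg p
  have hs : Summable fun t : ℕ × ℤ => qPoch α p t.1 / qPoch p p t.1 * a ^ t.1 *
      (a ^ t.2 * latticeG p a (m + t.2) *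
        (latticeG p a (k + t.2) * latticeG p a (t.1 + n + t.2))) := by
    refine Summable.of_norm_bounded (((summable_geometric_of_lt_one ha0.le ha1).mul_left C
      |>.mul_of_nonneg ((summable_int_pow_mul_abs_latticeG_add hp0 hp1 ha0 ha1 ha0.le ha1.le
        m).mul_right (besselGBound p * besselGBound p))) (fun i => by positivity)
      (fun s => by positivity)) fun t => ?_
    have h1 := abs_besselG_zpow_le hp0 hp1 ha0.le ha1.le (k + t.2)
    have h2 := abs_besselG_zpow_le hp0 hp1 ha0.le ha1.le (t.1 + n + t.2)
    have h3 := hC t.1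
    simp only [Real.norm_eq_abs, abs_mul, abs_pow, abs_of_pos ha0, abs_of_pos (zpow_pos ha0 _)]
    change |latticeG p a _| ≤ _ at h1
    change |latticeG p a _| ≤ _ at h2
    gcongr
  have h1 := hs.hasSum.prod_fiberwise fun i => (hs.prod_factor i).hasSum
  rw [← tripleSum_eq_tripleProd hp0 hp1 ha0 ha1, ← tsum_shift_eq_tripleSum ha0]
  have h2 : ∑' t : ℕ × ℤ, qPoch α p t.1 / qPoch p p t.1 * a ^ t.1 *
      (a ^ t.2 * latticeG p a (m + t.2) *
        (latticeG p a (k + t.2) * latticeG p a (t.1 + n + t.2))) =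
      ∑' r : ℤ, a ^ r * latticeG p a (m + r) * (latticeG p a (k + r) * latticeG p p (n + r)) := by
    rw [← (Equiv.prodComm ℕ ℤ).symm.tsum_eq]
    refine (hs.prod_symm.tsum_prod).trans (tsum_congr fun r => ?_)
    have h3 := (hasSum_qBinomial_latticeG hp0 hp1 ha0 ha1 hα (n + r)).mul_left
      (a ^ r * latticeG p a (m + r) * latticeG p a (k + r))
    rw [mul_assoc _ (latticeG p a (k + r))] at h3
    refine (h3.congr_fun fun i => ?_).tsum_eq
    simp only [Prod.fst_swap, Prod.snd_swap, add_assoc]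
    ring
  rw [h2] at h1
  exact h1.congr_fun fun i => tsum_mul_left.symm

/-! ### The kernels in terms of `besselG` -/

lemma mul_succ_eq_two_mul_choose (n : ℕ) : n * (n + 1) = 2 * (n.choose 2 + n) := by
  induction n with
  | zero => rfl
  | succ n ih =>
    rw [Nat.choose_succ_succ' n 1, Nat.choose_one_right]
    linarith

lemma jHE_eq_besselG {q v : ℝ} (hq0 : 0 < q) (hq1 : q < 1) (hv : -1 < v) (x : ℝ) :
    jHE q v x = besselG (q ^ 2) (q ^ (2 * v + 2)) (q ^ 2 * x ^ 2) /
      qPochInf (q ^ (2 * v + 2)) (q ^ 2) := by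
  have hp0 : 0 < q ^ 2 := by positivity
  have hp1 : q ^ 2 < 1 := pow_lt_one₀ hq0.le hq1 two_ne_zero
  have ha1 : q ^ (2 * v + 2) < 1 := Real.rpow_lt_one hq0.le hq1 (by linarith)
  rw [jHE, besselG, ← tsum_div_const]
  refine tsum_congr fun n => ?_
  have h1 := (qPoch_pos hp0 hp1 hp1 n).ne'
  have h2 := (qPoch_pos hp0 hp1 ha1 n).ne'
  have h3 := qPoch_mul_qPochInf hp0 hp1 (q ^ (2 * v + 2)) n
  have h4 := (qPochInf_pos hp0 hp1 ha1).ne'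
  rw [mul_succ_eq_two_mul_choose, eulerCoeff, pow_mul, pow_add, pow_mul x, mul_pow]
  rw [div_eq_div_iff (mul_ne_zero h1 h2) h4, ← h3]
  field_simp

lemma JHE_eq_besselG {p ν x : ℝ} (hp0 : 0 < p) :
    JHE p ν x = x ^ ν / qPochInf p p * besselG p (p ^ (ν + 1)) (p * x ^ 2) := by
  rw [JHE, besselG]
  congr 1
  refine tsum_congr fun n => ?_
  have h1 : (n : ℝ) * (n + 1) / 2 = ((n.choose 2 + n : ℕ) : ℝ) := by
    rw [div_eq_iff two_ne_zero, mul_comm _ (2 : ℝ)]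
    exact_mod_cast mul_succ_eq_two_mul_choose n
  rw [h1, Real.rpow_natCast, add_right_comm, Real.rpow_add hp0, Real.rpow_natCast, eulerCoeff,
    pow_add, pow_mul, mul_pow]
  ring

lemma sq_mul_zpow_sq {q : ℝ} (hq0 : 0 < q) (r : ℤ) : q ^ 2 * (q ^ r) ^ 2 = (q ^ 2) ^ (1 + r) := by
  rw [zpow_add₀ (pow_pos hq0 2).ne', zpow_one, ← zpow_natCast, ← zpow_natCast, ← zpow_mul,
    ← zpow_mul, mul_comm r]

lemma jHE_zpow {q v : ℝ} (hq0 : 0 < q) (hq1 : q < 1) (hv : -1 < v) (r : ℤ) :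
    jHE q v (q ^ r) = latticeG (q ^ 2) (q ^ (2 * v + 2)) r /
      qPochInf (q ^ (2 * v + 2)) (q ^ 2) := by
  rw [jHE_eq_besselG hq0 hq1 hv, sq_mul_zpow_sq hq0, latticeG]

lemma Dker_zpow {q v : ℝ} (hq0 : 0 < q) (hq1 : q < 1) (hv : -1 < v) (m n k : ℤ) :
    Dker q v (q ^ m) (q ^ n) (q ^ k) = (qPochInf (q ^ 2) (q ^ 2) ^ 2)⁻¹ *
      ((1 - q) * qPochInf (q ^ (2 * v + 2)) (q ^ 2))⁻¹ *
      ∑' r : ℤ, (q ^ (2 * v + 2)) ^ r * latticeG (q ^ 2) (q ^ (2 * v + 2)) (m + r) *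
        (latticeG (q ^ 2) (q ^ (2 * v + 2)) (k + r) *
          latticeG (q ^ 2) (q ^ (2 * v + 2)) (n + r)) := by
  have hp0 : 0 < q ^ 2 := by positivity
  have hp1 : q ^ 2 < 1 := pow_lt_one₀ hq0.le hq1 two_ne_zero
  have ha1 : q ^ (2 * v + 2) < 1 := Real.rpow_lt_one hq0.le hq1 (by linarith)
  have h1 := (qPochInf_pos hp0 hp1 hp1).ne'
  have h2 := (qPochInf_pos hp0 hp1 ha1).ne'
  have h3 : 1 - q ≠ 0 := (sub_pos.2 hq1).ne'
  rw [Dker, jackson, cqv, ← mul_assoc, ← tsum_mul_left, ← tsum_mul_left]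
  refine tsum_congr fun r => ?_
  have h4 : q ^ r * (q ^ r) ^ (2 * v + 1) = (q ^ (2 * v + 2)) ^ r := by
    rw [← Real.rpow_intCast, ← Real.rpow_intCast, ← Real.rpow_mul hq0.le, ← Real.rpow_mul hq0.le,
      ← Real.rpow_add hq0]
    congr 1
    ring
  rw [← h4, ← zpow_add₀ hq0.ne', ← zpow_add₀ hq0.ne', ← zpow_add₀ hq0.ne',
    jHE_zpow hq0 hq1 hv, jHE_zpow hq0 hq1 hv, jHE_zpow hq0 hq1 hv]
  field_simp

lemma Ekern_eq_tripleProd {q v : ℝ} (hq0 : 0 < q) (hq1 : q < 1) (hv : -1 < v) (m n k : ℤ) :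
    Ekern q v v m n k = (1 - q) * ((qPochInf (q ^ 2) (q ^ 2) ^ 2)⁻¹ *
      ((1 - q) * qPochInf (q ^ (2 * v + 2)) (q ^ 2))⁻¹ *
      (((q ^ (2 * v + 2)) ^ k)⁻¹ * tripleProd (q ^ 2) (q ^ (2 * v + 2)) (m - k) (n - k))) := by
  have hp0 : 0 < q ^ 2 := by positivity
  have hp1 : q ^ 2 < 1 := pow_lt_one₀ hq0.le hq1 two_ne_zero
  have ha1 : q ^ (2 * v + 2) < 1 := Real.rpow_lt_one hq0.le hq1 (by linarith)
  have h1 := (qPochInf_pos hp0 hp1 hp1).ne'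
  have h2 := (qPochInf_pos hp0 hp1 ha1).ne'
  have h3 : 1 - q ≠ 0 := (sub_pos.2 hq1).ne'
  have hc0 : cqv q (v - v) = 1 / (1 - q) := by
    rw [cqv, sub_self, mul_zero, zero_add, Real.rpow_two, mul_div_assoc, div_self h1, mul_one]
  have hx1 : q ^ (v - v + (m : ℝ) - k) = q ^ (m - k) := by
    rw [sub_self, zero_add, ← Real.rpow_intCast, Int.cast_sub]
  have hx2 : q ^ ((m : ℝ) - k) = q ^ (m - k) := by rw [← Real.rpow_intCast, Int.cast_sub]
  have hb1 : (q ^ 2) ^ ((n : ℝ) - k + 1) = (q ^ 2) ^ (1 + (n - k)) := by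
    rw [← Real.rpow_intCast]
    push_cast
    congr 1
    ring
  have hb2 : (q ^ 2) ^ (v + (n : ℝ) - k + 1) = q ^ (2 * v + 2) * (q ^ 2) ^ (n - k) := by
    rw [← Real.rpow_intCast, ← Real.rpow_natCast, ← Real.rpow_mul hq0.le, ← Real.rpow_mul hq0.le,
      ← Real.rpow_add hq0]
    push_cast
    congr 1
    ring
  have hpow : q ^ (-(k : ℝ) * (v + 2) - m * v - n * (v - v)) * (q ^ (m - k)) ^ ((n : ℝ) - k) *
      (q ^ (m - k)) ^ (v + n - k) =
      ((q ^ (2 * v + 2)) ^ k)⁻¹ * (q ^ 2) ^ ((m - k) * (n - k)) := by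
    rw [← zpow_neg]
    simp only [← Real.rpow_intCast, ← Real.rpow_natCast, ← Real.rpow_mul hq0.le,
      ← Real.rpow_add hq0]
    push_cast
    congr 1
    ring
  rw [Ekern, hc0, hx1, hx2, JHE_eq_besselG hp0, JHE_eq_besselG hp0, hb1, hb2, sq_mul_zpow_sq hq0,
    tripleProd, cqv]
  generalize q ^ (-(k : ℝ) * (v + 2) - m * v - n * (v - v)) = X at hpow ⊢
  generalize (q ^ (m - k)) ^ ((n : ℝ) - k) = Y at hpow ⊢
  generalize (q ^ (m - k)) ^ (v + n - k) = Z at hpow ⊢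
  generalize besselG _ _ _ = G
  generalize besselG _ _ _ = G'
  rw [← mul_assoc _ (qPochInf _ _ * _ * _), ← mul_assoc _ (qPochInf _ _ * _),
    mul_left_comm _ (qPochInf _ _), ← hpow]
  field_simp

/-- expansion of `E_{v,v}` in terms of the kernel `D_v`. -/
theorem stmt13 (q v : ℝ) (hq0 : 0 < q) (hq1 : q < 1) (hv : -1 < v) (n m k : ℤ) :
    Summable (fun i : ℕ =>
        |qPoch (q ^ (-(2 * v) : ℝ)) (q ^ 2) i / qPoch (q ^ 2) (q ^ 2) i *
          q ^ ((i : ℝ) * (2 + 2 * v)) *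
          Dker q v (q ^ (m : ℤ)) (q ^ ((i : ℤ) + n)) (q ^ (k : ℤ))|) ∧
    Ekern q v v m n k =
      (1 - q) * ∑' i : ℕ,
        qPoch (q ^ (-(2 * v) : ℝ)) (q ^ 2) i / qPoch (q ^ 2) (q ^ 2) i *
          q ^ ((i : ℝ) * (2 + 2 * v)) *
          Dker q v (q ^ (m : ℤ)) (q ^ ((i : ℤ) + n)) (q ^ (k : ℤ)) := by
  have hp0 : 0 < q ^ 2 := by positivity
  have hp1 : q ^ 2 < 1 := pow_lt_one₀ hq0.le hq1 two_ne_zero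
  have ha0 : 0 < q ^ (2 * v + 2) := Real.rpow_pos_of_pos hq0 _
  have ha1 : q ^ (2 * v + 2) < 1 := Real.rpow_lt_one hq0.le hq1 (by linarith)
  have hα : q ^ (-(2 * v)) * q ^ (2 * v + 2) = q ^ 2 := by
    rw [← Real.rpow_add hq0, neg_add_cancel_left, Real.rpow_two]
  have h := (hasSum_qBinomial_tripleLattice hp0 hp1 ha0 ha1 hα m n k).mul_left
    ((qPochInf (q ^ 2) (q ^ 2) ^ 2)⁻¹ * ((1 - q) * qPochInf (q ^ (2 * v + 2)) (q ^ 2))⁻¹)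
  have h' := h.congr_fun (g := fun i : ℕ =>
    qPoch (q ^ (-(2 * v))) (q ^ 2) i / qPoch (q ^ 2) (q ^ 2) i * q ^ ((i : ℝ) * (2 + 2 * v)) *
      Dker q v (q ^ m) (q ^ ((i : ℤ) + n)) (q ^ k)) fun i => by
    rw [Dker_zpow hq0 hq1 hv, mul_comm (i : ℝ), Real.rpow_mul hq0.le, Real.rpow_natCast,
      add_comm 2 (2 * v)]
    ring
  exact ⟨h'.summable.abs, by rw [h'.tsum_eq, Ekern_eq_tripleProd hq0 hq1 hv]⟩
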